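/- Let Δ be a pure simplicial complex on [n], let r ≥ 2, and let s be an integer. Then s ≤ S_r-depth(k[Δ]) if and only if the reduced simplicial homology H̃_i(link_Δ F; k) vanishes for all integers i ≤ r − 2 and all faces F ∈ Δ with |F| ≤ s − i − 2. -/

import Mathlib

/-!
Common definitions for formalizing "The Serre depth of Stanley–Reisner rings and
the depth of their symbolic powers" (Muta–Terai).
-/

open CategoryTheory MvPolynomial

noncomputable section

namespace SerrePaper

/-! ### Simplicial complexes (given by their sets of faces) -/

variable {V : Type}

/-- A (nonempty, downward closed) abstract simplicial complex, given by its set of faces. -/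
def IsComplex (K : Set (Finset V)) : Prop :=
  K.Nonempty ∧ ∀ F ∈ K, ∀ G ⊆ F, G ∈ K

/-- `F` is a facet (maximal face) of `K`. -/
def IsFacet (K : Set (Finset V)) (F : Finset V) : Prop :=
  F ∈ K ∧ ∀ G ∈ K, F ⊆ G → G = F

/-- `K` is pure: all facets have the same cardinality. -/
def Pure (K : Set (Finset V)) : Prop :=
  ∀ F G : Finset V, IsFacet K F → IsFacet K G → F.card = G.card

/-- `dim K = d - 1`, i.e. the maximal cardinality of a face of `K` is `d`. -/
def HasDimCard (K : Set (Finset V)) (d : ℕ) : Prop :=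
  (∃ F ∈ K, F.card = d) ∧ ∀ F ∈ K, F.card ≤ d

/-- the link of the face `F` in `K`. -/
def link [DecidableEq V] (K : Set (Finset V)) (F : Finset V) : Set (Finset V) :=
  { G | G ∪ F ∈ K ∧ G ∩ F = ∅ }

/-- `skeleton K t` is the `(t-1)`-skeleton `K^{t-1}` of `K`:
all faces with at most `t` vertices. -/
def skeleton (K : Set (Finset V)) (t : ℕ) : Set (Finset V) :=
  { F ∈ K | F.card ≤ t }

/-- The Alexander dual complex `K^∨ = { F | complement of F is not a face of K }`. -/
def dualComplex [Fintype V] [DecidableEq V] (K : Set (Finset V)) : Set (Finset V) :=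
  { F | Fᶜ ∉ K }

/-- The copy of `K` on its own vertex set (as a complex on the corresponding subtype). -/
def restrictVerts (K : Set (Finset V)) : Set (Finset {v : V // {v} ∈ K}) :=
  { F | F.map (Function.Embedding.subtype _) ∈ K }

/-- The induced subcomplex `K_W` on a subset `W` of the vertices. -/
def inducedSub (K : Set (Finset V)) (W : Finset V) : Set (Finset V) :=
  { F ∈ K | F ⊆ W }

/-- `K` is a matroid complex: every induced subcomplex is pure. -/
def IsMatroidComplex (K : Set (Finset V)) : Prop :=
  ∀ W : Finset V, Pure (inducedSub K W)

/-! ### Reduced simplicial homology with coefficients in a field `k` -/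

/-- The group of simplicial `(c-1)`-chains: formal `k`-linear combinations of the
faces of `K` with exactly `c` vertices. -/
abbrev chainGroup (k : Type) [Field k] (K : Set (Finset V)) (c : ℕ) : Type :=
  {F : Finset V // F ∈ K ∧ F.card = c} →₀ k

open Classical in
/-- the boundary of a single face, `∂F = ∑_{x ∈ F} (-1)^{pos of x in F} (F \ {x})`. -/
def boundaryAt (k : Type) [Field k] [LinearOrder V] (K : Set (Finset V)) (c : ℕ)
    (F : {F : Finset V // F ∈ K ∧ F.card = c + 1}) : chainGroup k K c :=
  ∑ x ∈ F.1.attach,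
    if h : F.1.erase x.1 ∈ K then
      Finsupp.single
        ⟨F.1.erase x.1, h, by simp [Finset.card_erase_of_mem x.2, F.2.2]⟩
        ((-1 : k) ^ (F.1.filter (fun y => y < x.1)).card)
    else 0

/-- The simplicial boundary map (for a downward closed `K` this is the usual
boundary map of the reduced (augmented) chain complex of `K`, where faces with
`c` vertices sit in homological degree `c - 1`). -/
def boundary (k : Type) [Field k] [LinearOrder V] (K : Set (Finset V)) (c : ℕ) :
    chainGroup k K (c + 1) →ₗ[k] chainGroup k K c :=
  Finsupp.lsum k fun F => LinearMap.toSpanSingleton k _ (boundaryAt k K c F)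

/-- `H̃ᵢ(K; k) = 0`: every reduced `i`-cycle is a boundary.  (For `i ≤ -2` this holds
trivially; for `i = -1` the relevant cycle group is the whole of the `(-1)`-chains.) -/
def reducedHomologyVanishes (k : Type) [Field k] [LinearOrder V]
    (K : Set (Finset V)) (i : ℤ) : Prop :=
  if i < -1 then True
  else if i = -1 then
    ∀ z : chainGroup k K 0, ∃ b : chainGroup k K 1, boundary k K 0 b = z
  else
    ∀ z : chainGroup k K (i.toNat + 1), boundary k K i.toNat z = 0 →
      ∃ b : chainGroup k K (i.toNat + 2), boundary k K (i.toNat + 1) b = z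

/-- Nonvanishing `β_{i,j}(k[K]) ≠ 0` of the graded Betti numbers of the
Stanley–Reisner ring of `K`, expressed via Hochster's formula:
`β_{i,j}(k[K]) = ∑_{W ⊆ V, |W| = j} dim_k H̃_{j-i-1}(K_W; k)`. -/
def bettiNonzero (k : Type) [Field k] [LinearOrder V] (K : Set (Finset V)) (i j : ℕ) : Prop :=
  ∃ W : Finset V, W.card = j ∧
    ¬ reducedHomologyVanishes k (inducedSub K W) ((j : ℤ) - i - 1)

/-- `reg_{≤ r} I_K = max{ j : β_{i,i+j}(I_K) ≠ 0 for some i ≤ r }`, where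
`β_{i,d}(I_K) = β_{i+1,d}(k[K])`. -/
def regLEIdeal (k : Type) [Field k] [LinearOrder V] (K : Set (Finset V)) (r : ℕ) : ℕ :=
  sSup { j : ℕ | ∃ i ≤ r, bettiNonzero k K (i + 1) (i + j) }

/-- `indeg I_K`: the least degree of a minimal generator of the Stanley–Reisner
ideal of `K`, i.e. `min{ j : β_{0,j}(I_K) = β_{1,j}(k[K]) ≠ 0 }`. -/
def indegIdeal (k : Type) [Field k] [LinearOrder V] (K : Set (Finset V)) : ℕ :=
  sInf { j : ℕ | bettiNonzero k K 1 j }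

/-! ### Stanley–Reisner rings, Serre depth, depth, symbolic powers -/

variable (k : Type) [Field k]

/-- The Stanley–Reisner ideal of `K` (generated by the monomials of the non-faces,
equivalently by those of the minimal non-faces). -/
def srIdeal (K : Set (Finset V)) : Ideal (MvPolynomial V k) :=
  Ideal.span { m | ∃ F : Finset V, F ∉ K ∧ m = ∏ i ∈ F, X i }

/-- The homogeneous maximal ideal `(x_v : v ∈ V)` of the polynomial ring. -/
def maxIdeal (V : Type) : Ideal (MvPolynomial V k) :=
  Ideal.span (Set.range X)

/-- The quotient ring `S/I` as an object of `ModuleCat S`. -/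
def quotMod {V : Type} (I : Ideal (MvPolynomial V k)) : ModuleCat (MvPolynomial V k) :=
  ModuleCat.of _ (MvPolynomial V k ⧸ I)

/-- The Stanley–Reisner ring `k[K] = S/I_K` as a module over `S`. -/
def srRing (K : Set (Finset V)) : ModuleCat (MvPolynomial V k) :=
  quotMod k (srIdeal k K)

/-- The Krull dimension of a module, `dim M = dim (R / ann M)` (so `dim 0 = ⊥ = -∞`). -/
def modDim {R : Type} [CommRing R] (M : ModuleCat R) : WithBot ℕ∞ :=
  ringKrullDim (R ⧸ Module.annihilator R M)

/-- `Ext_R^i(M, N)` as an `R`-module. -/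
def extM {R : Type} [CommRing R] (M N : ModuleCat R) (i : ℕ) : ModuleCat R :=
  ((Ext R (ModuleCat R) i).obj (Opposite.op M)).obj N

/-- `K_M^j = Ext_S^{n-j}(M, ω_S)`, the (Matlis dual of) local cohomology; since the
canonical module `ω_S` of the polynomial ring `S` is `S` itself up to a
grading shift, we use `Ext_S^{n-j}(M, S)`. -/
def serreK {V : Type} (M : ModuleCat (MvPolynomial V k)) (j : ℕ) :
    ModuleCat (MvPolynomial V k) :=
  extM M (ModuleCat.of _ (MvPolynomial V k)) (Nat.card V - j)

/-- The Serre depth `S_r-depth(M) = min{ j : dim K_M^j ≥ j - r + 1 }`.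
(Note that, since `dim K_M^j` is either `⊥` or `≥ 0`, the inequality
`dim K_M^j ≥ j - r + 1` of (possibly negative) integers is equivalent to
`(j + 1 - r : ℕ) ≤ dim K_M^j` with truncated subtraction.) -/
def serreDepth {V : Type} (r : ℕ) (M : ModuleCat (MvPolynomial V k)) : ℕ :=
  sInf { j : ℕ | ((j + 1 - r : ℕ) : WithBot ℕ∞) ≤ modDim (serreK k M j) }

/-- Serre's condition `(S_r)` for an unmixed module: `S_r-depth(M) = dim M`. -/
def serreCond {V : Type} (r : ℕ) (M : ModuleCat (MvPolynomial V k)) : Prop :=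
  (serreDepth k r M : WithBot ℕ∞) = modDim M

/-- The depth of `M` with respect to the homogeneous maximal ideal,
via Rees' characterization `depth M = min{ i : Ext^i(S/m, M) ≠ 0 }`. -/
def mdepth {V : Type} (M : ModuleCat (MvPolynomial V k)) : ℕ :=
  sInf { i : ℕ | Nontrivial (extM (quotMod k (maxIdeal k V)) M i) }

/-- `M` is Cohen–Macaulay: `depth M = dim M`. -/
def isCM {V : Type} (M : ModuleCat (MvPolynomial V k)) : Prop :=
  (mdepth k M : WithBot ℕ∞) = modDim M

/-- The `ℓ`-th symbolic power of a (radical, e.g. squarefree monomial) ideal: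
`I^(ℓ) = ⋂_{P ∈ Min(I)} P^ℓ`. -/
def symbPow {R : Type} [CommRing R] (I : Ideal R) (ℓ : ℕ) : Ideal R :=
  sInf { J | ∃ P ∈ I.minimalPrimes, J = P ^ ℓ }

/-- The height of an ideal: the Krull dimension of the poset of primes contained in it. -/
def idealHeight {R : Type} [CommRing R] (p : Ideal R) : WithBot ℕ∞ :=
  Order.krullDim { q : PrimeSpectrum R // q.asIdeal ≤ p }

/-- `R/I` is unmixed: all associated primes of `R/I` have the same height. -/
def IsUnmixedIdeal {R : Type} [CommRing R] (I : Ideal R) : Prop :=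
  ∀ p q : Ideal R, p ∈ associatedPrimes R (R ⧸ I) → q ∈ associatedPrimes R (R ⧸ I) →
    idealHeight p = idealHeight q

/-- Nonvanishing of the first local cohomology `H_m^1(S/I) ≠ 0`. -/
def H1NE {V : Type} (I : Ideal (MvPolynomial V k)) : Prop :=
  Nontrivial ((localCohomology (maxIdeal k V) 1).obj (quotMod k I))

/-- `I` is a squarefree monomial ideal. -/
def IsSqFreeMonomialIdeal {V : Type} (I : Ideal (MvPolynomial V k)) : Prop :=
  ∃ G : Set (Finset V), I = Ideal.span ((fun F => ∏ i ∈ F, X i) '' G)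

end SerrePaper

end
namespace SerrePaper

section Interface

variable {R : Type} [CommRing R]

/-- The chain complex of `R`-modules built from a sequence of linear maps with vanishing
consecutive compositions. -/
noncomputable def linearChainComplex (T : ℕ → Type) [∀ p, AddCommGroup (T p)]
    [∀ p, Module R (T p)] (d : ∀ p, T (p + 1) →ₗ[R] T p)
    (hd : ∀ p, d p ∘ₗ d (p + 1) = 0) : ChainComplex (ModuleCat R) ℕ :=
  ChainComplex.of (fun p => ModuleCat.of R (T p)) (fun p => ModuleCat.ofHom (d p))
    (fun p => by rw [← ModuleCat.ofHom_comp, hd]; rfl)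

lemma mem_annihilator_homology_iff (C : ShortComplex (ModuleCat R)) (s : R) :
    s ∈ Module.annihilator R C.homology ↔
      ∀ x : C.X₂, C.g x = 0 → ∃ y : C.X₁, C.f y = s • x := by
  rw [LinearEquiv.annihilator_eq C.moduleCatHomologyIso.toLinearEquiv, Module.mem_annihilator]
  constructor
  · intro h x hx
    have := h (Submodule.Quotient.mk ⟨x, hx⟩)
    erw [← Submodule.Quotient.mk_smul, Submodule.Quotient.mk_eq_zero] at this
    obtain ⟨y, hy⟩ := this
    exact ⟨y, congrArg Subtype.val hy⟩
  · intro h q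
    obtain ⟨x, rfl⟩ := Submodule.Quotient.mk_surjective _ q
    erw [← Submodule.Quotient.mk_smul, Submodule.Quotient.mk_eq_zero]
    obtain ⟨y, hy⟩ := h x.1 x.2
    exact ⟨y, Subtype.ext hy⟩

variable (T : ℕ → Type) [∀ p, AddCommGroup (T p)] [∀ p, Module R (T p)]
    (d : ∀ p, T (p + 1) →ₗ[R] T p)

@[simp]
lemma linearChainComplex_d (hd : ∀ p, d p ∘ₗ d (p + 1) = 0) (p : ℕ) :
    (linearChainComplex T d hd).d (p + 1) p = ModuleCat.ofHom (d p) :=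
  ChainComplex.of_d (fun p => ModuleCat.of R (T p)) (fun p => ModuleCat.ofHom (d p)) p

lemma exists_projectiveResolution
    (hd : ∀ p, d p ∘ₗ d (p + 1) = 0) [∀ p, Module.Projective R (T p)]
    (hex : ∀ p x, d p x = 0 → ∃ y, d (p + 1) y = x)
    (M : Type) [AddCommGroup M] [Module R M] (aug : T 0 →ₗ[R] M)
    (hsurj : Function.Surjective aug) (hker : ∀ x, aug x = 0 → ∃ y, d 0 y = x)
    (haug : aug ∘ₗ d 0 = 0) :
    ∃ P : ProjectiveResolution (ModuleCat.of R M), P.complex = linearChainComplex T d hd := by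
  refine ⟨{ complex := linearChainComplex T d hd
            projective := fun p => ?_
            π := (ChainComplex.toSingle₀Equiv _ _).symm ⟨ModuleCat.ofHom aug, ?_⟩
            quasiIso := ⟨fun n => ?_⟩ }, rfl⟩
  · exact (inferInstance : Projective (ModuleCat.of R (T p)))
  · rw [linearChainComplex_d]
    erw [← ModuleCat.ofHom_comp, haug]; rfl
  · cases n
    · rw [ChainComplex.quasiIsoAt₀_iff, ShortComplex.quasiIso_iff_of_zeros' _ rfl rfl rfl]
      constructor
      · rw [ShortComplex.moduleCat_exact_iff]
        intro x hx
        obtain ⟨y, hy⟩ := hker x (by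
          simpa using! hx)
        refine ⟨y, ?_⟩
        change ((linearChainComplex T d hd).d 1 0) y = x
        rw [linearChainComplex_d]
        exact hy
      · rw [ModuleCat.epi_iff_surjective]
        simpa using! hsurj
    · rename_i n
      rw [quasiIsoAt_iff_exactAt' (hL := ChainComplex.exactAt_succ_single_obj ..),
          HomologicalComplex.exactAt_iff' _ (n + 2) (n + 1) n (by simp) (by simp),
          ShortComplex.moduleCat_exact_iff]
      intro x hx
      change ((linearChainComplex T d hd).d (n + 1) n) x = 0 at hx
      rw [linearChainComplex_d] at hx
      obtain ⟨y, hy⟩ := hex n x hx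
      refine ⟨y, ?_⟩
      change ((linearChainComplex T d hd).d (n + 2) (n + 1)) y = x
      rw [linearChainComplex_d]
      exact hy

lemma linearYonedaObj_d_apply (hd : ∀ p, d p ∘ₗ d (p + 1) = 0) (N : Type)
    [AddCommGroup N] [Module R N] (p : ℕ)
    (f : T p →ₗ[R] N) :
    ((linearChainComplex T d hd).linearYonedaObj R (ModuleCat.of R N)).d p (p + 1)
      (ModuleCat.ofHom f) = ModuleCat.ofHom (f ∘ₗ d p) := by
  rw [ChainComplex.linearYonedaObj_d]
  change (linearChainComplex T d hd).d (p + 1) p ≫ ModuleCat.ofHom f = _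
  rw [linearChainComplex_d]
  rfl

lemma mem_annihilator_extM_zero_iff
    (hd : ∀ p, d p ∘ₗ d (p + 1) = 0) [∀ p, Module.Projective R (T p)]
    (hex : ∀ p x, d p x = 0 → ∃ y, d (p + 1) y = x)
    (M : Type) [AddCommGroup M] [Module R M] (aug : T 0 →ₗ[R] M)
    (hsurj : Function.Surjective aug) (hker : ∀ x, aug x = 0 → ∃ y, d 0 y = x)
    (haug : aug ∘ₗ d 0 = 0) (N : Type) [AddCommGroup N]
    [Module R N] (s : R) :
    s ∈ Module.annihilator R (extM (ModuleCat.of R M) (ModuleCat.of R N) 0) ↔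
      ∀ f : T 0 →ₗ[R] N, f ∘ₗ d 0 = 0 → s • f = 0 := by
  obtain ⟨P, hP⟩ := exists_projectiveResolution T d hd hex M aug hsurj hker haug
  rw [extM, LinearEquiv.annihilator_eq (P.isoExt 0 (ModuleCat.of R N)).toLinearEquiv, hP]
  let C := (linearChainComplex T d hd).linearYonedaObj R (ModuleCat.of R N)
  let e : C.homology 0 ≅ (C.sc' 0 0 1).homology :=
    ShortComplex.homologyMapIso (C.isoSc' 0 0 1 (by simp) (by simp))
  rw [LinearEquiv.annihilator_eq e.toLinearEquiv]
  refine (mem_annihilator_homology_iff _ s).trans ?_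
  have h0 : (C.sc' 0 0 1).f = 0 := C.shape 0 0 (by simp)
  constructor
  · intro h f hf
    obtain ⟨y, hy⟩ := h (ModuleCat.ofHom f) (by
      refine (linearYonedaObj_d_apply T d hd N 0 f).trans ?_
      rw [hf]; rfl)
    rw [h0] at hy
    exact congrArg ModuleCat.Hom.hom hy.symm
  · intro h x hx
    have h2 := (linearYonedaObj_d_apply T d hd N 0 x.hom).symm.trans hx
    have h3 := h x.hom (congrArg ModuleCat.Hom.hom h2)
    refine ⟨0, ?_⟩
    rw [map_zero]
    exact congrArg ModuleCat.ofHom h3.symm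

lemma mem_annihilator_extM_succ_iff
    (hd : ∀ p, d p ∘ₗ d (p + 1) = 0) [∀ p, Module.Projective R (T p)]
    (hex : ∀ p x, d p x = 0 → ∃ y, d (p + 1) y = x)
    (M : Type) [AddCommGroup M] [Module R M] (aug : T 0 →ₗ[R] M)
    (hsurj : Function.Surjective aug) (hker : ∀ x, aug x = 0 → ∃ y, d 0 y = x)
    (haug : aug ∘ₗ d 0 = 0) (N : Type) [AddCommGroup N]
    [Module R N] (p : ℕ) (s : R) :
    s ∈ Module.annihilator R (extM (ModuleCat.of R M) (ModuleCat.of R N) (p + 1)) ↔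
      ∀ f : T (p + 1) →ₗ[R] N, f ∘ₗ d (p + 1) = 0 → ∃ g : T p →ₗ[R] N, g ∘ₗ d p = s • f := by
  obtain ⟨P, hP⟩ := exists_projectiveResolution T d hd hex M aug hsurj hker haug
  rw [extM, LinearEquiv.annihilator_eq (P.isoExt (p + 1) (ModuleCat.of R N)).toLinearEquiv, hP]
  let C := (linearChainComplex T d hd).linearYonedaObj R (ModuleCat.of R N)
  let e : C.homology (p + 1) ≅ (C.sc' p (p + 1) (p + 2)).homology :=
    ShortComplex.homologyMapIso (C.isoSc' p (p + 1) (p + 2) (by simp) (by simp))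
  rw [LinearEquiv.annihilator_eq e.toLinearEquiv]
  refine (mem_annihilator_homology_iff _ s).trans ?_
  constructor
  · intro h f hf
    obtain ⟨y, hy⟩ := h (ModuleCat.ofHom f) (by
      refine (linearYonedaObj_d_apply T d hd N (p + 1) f).trans ?_
      rw [hf]; rfl)
    refine ⟨ModuleCat.Hom.hom y, ?_⟩
    have h2 := (linearYonedaObj_d_apply T d hd N p y.hom).symm.trans hy
    exact congrArg ModuleCat.Hom.hom h2
  · intro h x hx
    have h2 := (linearYonedaObj_d_apply T d hd N (p + 1) x.hom).symm.trans hx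
    obtain ⟨g, hg⟩ := h x.hom (congrArg ModuleCat.Hom.hom h2)
    refine ⟨ModuleCat.ofHom g, ?_⟩
    refine (linearYonedaObj_d_apply T d hd N p g).trans ?_
    rw [hg]
    rfl

end Interface

section Koszul

variable {V : Type} [LinearOrder V] {R : Type} [CommRing R]

/-- The sign `(-1) ^ #{y ∈ A | y < b}` with which the vertex `b` enters boundary maps. -/
def sg (R : Type) [CommRing R] (b : V) (A : Finset V) : R :=
  (-1) ^ (A.filter (fun y => y < b)).card

lemma isUnit_sg (b : V) (A : Finset V) : IsUnit (sg R b A) :=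
  isUnit_one.neg.pow _

@[simp]
lemma sg_mul_self (b : V) (A : Finset V) : sg R b A * sg R b A = 1 := by
  rw [sg, ← mul_pow]; simp

lemma sg_union (b : V) {A B : Finset V} (h : Disjoint A B) :
    sg R b (A ∪ B) = sg R b A * sg R b B := by
  rw [sg, Finset.filter_union, Finset.card_union_of_disjoint, pow_add, sg, sg]
  exact Finset.disjoint_filter_filter h

lemma sg_singleton_of_lt {b c : V} (h : c < b) : sg R b {c} = -1 := by
  simp [sg, Finset.filter_singleton, h]

lemma sg_singleton_of_le {b c : V} (h : b ≤ c) : sg R b {c} = 1 := by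
  simp [sg, Finset.filter_singleton, not_lt.2 h]

lemma sg_insert_of_lt {b c : V} {A : Finset V} (h : c < b) (hc : c ∉ A) :
    sg R b (insert c A) = - sg R b A := by
  rw [Finset.insert_eq, sg_union b (by simpa using hc), sg_singleton_of_lt h, neg_one_mul]

lemma sg_insert_of_le {b c : V} {A : Finset V} (h : b ≤ c) (hc : c ∉ A) :
    sg R b (insert c A) = sg R b A := by
  rw [Finset.insert_eq, sg_union b (by simpa using hc), sg_singleton_of_le h, one_mul]

@[simp]
lemma sg_erase_self (b : V) (A : Finset V) : sg R b (A.erase b) = sg R b A := by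
  by_cases hb : b ∈ A
  · conv_rhs => rw [← Finset.insert_erase hb]
    rw [sg_insert_of_le le_rfl (by simp)]
  · rw [Finset.erase_eq_of_notMem hb]

lemma map_sg {R' : Type} [CommRing R'] (f : R →+* R') (b : V) (A : Finset V) :
    f (sg R b A) = sg R' b A := by
  simp [sg]

/-- Exactness of the Koszul cochain complex of a sequence all of whose subsequences are
regular, with the top cohomology corrected. -/
lemma koszul_exact (y : V → R)
    (hy : ∀ (U : Finset V) (i : V), i ∉ U → ∀ a, y i * a ∈ Ideal.span (y '' (U : Set V)) →
      a ∈ Ideal.span (y '' (U : Set V))) (U : Finset V) :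
    ∀ (p : ℕ) (g : Finset V → R),
      (∀ B ⊆ U, B.card = p + 1 → ∑ b ∈ B, sg R b B * (y b * g (B.erase b)) = 0) →
      (p = U.card → g U ∈ Ideal.span (y '' (U : Set V))) →
      ∃ h : Finset V → R, ∀ B ⊆ U, B.card = p →
        g B = ∑ b ∈ B, sg R b B * (y b * h (B.erase b)) := by
  induction U using Finset.induction_on_min with
  | empty =>
    intro p g _ htop
    refine ⟨0, fun B hB hp => ?_⟩
    obtain rfl := Finset.subset_empty.1 hB
    simpa using htop (by simpa using hp.symm)
  | insert i U hi ih =>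
    intro p g hg htop
    have hiU : i ∉ U := fun h => lt_irrefl _ (hi i h)
    have key : ∀ (f : Finset V → R), ∀ B ⊆ U,
        ∑ b ∈ insert i B, sg R b (insert i B) * (y b * f ((insert i B).erase b)) =
          y i * f B - ∑ b ∈ B, sg R b B * (y b * f (insert i (B.erase b))) := by
      intro f B hB
      have hiB : i ∉ B := fun h => hiU (hB h)
      rw [Finset.sum_insert hiB, Finset.erase_insert hiB, sg_insert_of_le le_rfl hiB, sub_eq_add_neg,
        ← Finset.sum_neg_distrib]
      congr 1
      · have : sg R i B = 1 := by
          rw [sg, Finset.filter_false_of_mem, Finset.card_empty, pow_zero]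
          exact fun x hx => not_lt.2 (hi x (hB hx)).le
        rw [this, one_mul]
      · refine Finset.sum_congr rfl fun b hb => ?_
        rw [sg_insert_of_lt (hi b (hB hb)) hiB, Finset.erase_insert_of_ne, neg_mul]
        rintro rfl
        exact hiB hb
    have hsub : U ⊆ insert i U := Finset.subset_insert _ _
    have h1 : ∃ h1 : Finset V → R, (∀ B ⊆ U, B.card = p →
        g B = ∑ b ∈ B, sg R b B * (y b * h1 (B.erase b))) ∧
        (p = U.card + 1 → g (insert i U) - y i * h1 U ∈ Ideal.span (y '' (U : Set V))) := by
      by_cases hp : p = U.card + 1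
      · have := htop (by rw [Finset.card_insert_of_notMem hiU, hp])
        rw [Finset.coe_insert, Set.image_insert_eq, Ideal.mem_span_insert] at this
        obtain ⟨c, z, hz, hcz⟩ := this
        refine ⟨fun _ => c, fun B hB hBp => ?_, fun _ => ?_⟩
        · have := Finset.card_le_card hB
          omega
        · rw [hcz]
          convert hz using 1
          ring
      · obtain ⟨h1, hh1⟩ := ih p g (fun B hB => hg B (hB.trans hsub)) (by
          rintro rfl
          refine hy U i hiU _ ?_
          have := hg (insert i U) subset_rfl (Finset.card_insert_of_notMem hiU)
          rw [key g U subset_rfl, sub_eq_zero] at this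
          rw [this]
          refine Ideal.sum_mem _ fun b hb => Ideal.mul_mem_left _ _ (Ideal.mul_mem_right _ _ ?_)
          exact Ideal.subset_span ⟨b, hb, rfl⟩)
        exact ⟨h1, hh1, fun h => absurd h hp⟩
    obtain ⟨h1, hh1, h1top⟩ := h1
    have hsplit : ∀ B ⊆ insert i U, B ⊆ U ∨ ∃ B' ⊆ U, B = insert i B' := by
      intro B hB
      by_cases hiB : i ∈ B
      · refine Or.inr ⟨B.erase i, ?_, (Finset.insert_erase hiB).symm⟩
        rwa [← Finset.subset_insert_iff]
      · exact Or.inl ((Finset.subset_insert_iff_of_notMem hiB).1 hB)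
    rcases p with _ | q
    · refine ⟨h1, fun B hB hp => ?_⟩
      obtain rfl := Finset.card_eq_zero.1 hp
      exact hh1 ∅ (by simp) rfl
    · obtain ⟨h2, hh2⟩ := ih q (fun B => y i * h1 B - g (insert i B)) (by
        intro B hB hBq
        have e1 := hg (insert i B) (Finset.insert_subset_insert i hB) (by
          rw [Finset.card_insert_of_notMem (fun h => hiU (hB h)), hBq])
        rw [key g B hB, hh1 B hB hBq, Finset.mul_sum, ← Finset.sum_sub_distrib] at e1
        rw [← e1]
        refine Finset.sum_congr rfl fun b _ => ?_
        ring) (by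
        rintro rfl
        rw [← neg_mem_iff, neg_sub]
        exact h1top rfl)
      obtain ⟨f, hf⟩ : ∃ f : Finset V → R, ∀ B, f B = if i ∈ B then h2 (B.erase i) else h1 B :=
        ⟨_, fun _ => rfl⟩
      refine ⟨f, fun B hB hBp => ?_⟩
      rcases hsplit B hB with hB' | ⟨B', hB', rfl⟩
      · rw [hh1 B hB' hBp]
        refine Finset.sum_congr rfl fun b _ => ?_
        rw [hf, if_neg fun h => hiU (hB' (Finset.mem_of_mem_erase h))]
      · have hiB : i ∉ B' := fun h => hiU (hB' h)
        rw [Finset.card_insert_of_notMem hiB, Nat.add_right_cancel_iff] at hBp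
        rw [key f B' hB', hf B', if_neg hiB, ← sub_sub_cancel (y i * h1 B') (g (insert i B')),
          hh2 B' hB' hBp]
        congr 1
        refine Finset.sum_congr rfl fun b _ => ?_
        rw [hf, if_pos (Finset.mem_insert_self _ _), Finset.erase_insert]
        exact fun h => hiB (Finset.mem_of_mem_erase h)

end Koszul

section Monomial

variable {k : Type} [Field k] {n : ℕ}

/-- The ideal generated by the variables outside `F`. -/
noncomputable def faceIdeal (k : Type) [Field k] {n : ℕ} (F : Finset (Fin n)) :
    Ideal (MvPolynomial (Fin n) k) :=
  Ideal.span (X '' ((Fᶜ : Finset (Fin n)) : Set (Fin n)))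

lemma mem_faceIdeal {F : Finset (Fin n)} {f : MvPolynomial (Fin n) k} :
    f ∈ faceIdeal k F ↔ ∀ m : Fin n →₀ ℕ, m.support ⊆ F → coeff m f = 0 := by
  rw [faceIdeal, mem_ideal_span_X_image]
  refine forall_congr' fun m => ?_
  rw [mem_support_iff, not_imp_comm, Finset.subset_iff]
  refine imp_congr_left ⟨fun h i hi => ?_, fun h => ?_⟩
  · by_contra hF
    exact h ⟨i, by simpa using hF, by simpa using hi⟩
  · rintro ⟨i, hi, hm⟩
    simp only [Finset.coe_compl, Set.mem_compl_iff, SetLike.mem_coe] at hi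
    exact hi (h (by simpa using hm))

lemma X_mem_faceIdeal {F : Finset (Fin n)} {i : Fin n} (h : i ∉ F) :
    (X i : MvPolynomial (Fin n) k) ∈ faceIdeal k F :=
  Ideal.subset_span ⟨i, by simpa using h, rfl⟩

lemma mem_span_X_of_X_mul_mem {U : Finset (Fin n)} {i : Fin n} (hi : i ∉ U)
    {a : MvPolynomial (Fin n) k}
    (h : X i * a ∈ Ideal.span (X '' (U : Set (Fin n)) : Set (MvPolynomial (Fin n) k))) :
    a ∈ Ideal.span (X '' (U : Set (Fin n)) : Set (MvPolynomial (Fin n) k)) := by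
  rw [mem_ideal_span_X_image] at h ⊢
  intro m hm
  obtain ⟨j, hj, hmj⟩ := h (Finsupp.single i 1 + m) (by
    rw [mem_support_iff, coeff_X_mul]
    exact mem_support_iff.1 hm)
  refine ⟨j, hj, ?_⟩
  have : i ≠ j := by rintro rfl; exact hi hj
  simpa [Finsupp.single_apply, this] using hmj

lemma span_image_unit_mul {R ι : Type} [CommRing R] (u x : ι → R) (hu : ∀ i, IsUnit (u i))
    (U : Set ι) : Ideal.span ((fun i => u i * x i) '' U) = Ideal.span (x '' U) := by
  refine le_antisymm (Ideal.span_le.2 ?_) (Ideal.span_le.2 ?_)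
  · rintro _ ⟨i, hi, rfl⟩
    exact Ideal.mul_mem_left _ _ (Ideal.subset_span ⟨i, hi, rfl⟩)
  · rintro _ ⟨i, hi, rfl⟩
    exact (Ideal.unit_mul_mem_iff_mem _ (hu i)).1 (Ideal.subset_span ⟨i, hi, rfl⟩)

lemma koszul_exact_unit_mul_X (u : Fin n → MvPolynomial (Fin n) k) (hu : ∀ i, IsUnit (u i))
    (U : Finset (Fin n)) (p : ℕ) (g : Finset (Fin n) → MvPolynomial (Fin n) k)
    (hg : ∀ B ⊆ U, B.card = p + 1 → ∑ b ∈ B, sg _ b B * (u b * X b * g (B.erase b)) = 0)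
    (htop : p = U.card → g U ∈ Ideal.span (X '' (U : Set (Fin n)) : Set (MvPolynomial (Fin n) k))) :
    ∃ h : Finset (Fin n) → MvPolynomial (Fin n) k, ∀ B ⊆ U, B.card = p →
      g B = ∑ b ∈ B, sg _ b B * (u b * X b * h (B.erase b)) := by
  refine koszul_exact (fun i => u i * X i) (fun U i hi a ha => ?_) U p g hg (fun hp => ?_)
  · rw [span_image_unit_mul u _ hu] at ha ⊢
    rw [mul_assoc, Ideal.unit_mul_mem_iff_mem _ (hu i)] at ha
    exact mem_span_X_of_X_mul_mem hi ha
  · rw [span_image_unit_mul u _ hu]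
    exact htop hp

lemma sg_compl (b : Fin n) (B : Finset (Fin n)) :
    sg (MvPolynomial (Fin n) k) b Bᶜ = sg _ b B * sg _ b Finset.univ := by
  rw [← Finset.union_compl B, sg_union b disjoint_compl_right, ← mul_assoc, sg_mul_self, one_mul]

/-- Koszul exactness in the form used for the columns of the dual complex. -/
lemma koszul_exact_cochain (F : Finset (Fin n)) (p : ℕ)
    (g : Finset (Fin n) → MvPolynomial (Fin n) k)
    (hg : ∀ B, Disjoint F B → B.card = p + 1 → ∑ b ∈ B, sg _ b Bᶜ * (X b * g (B.erase b)) = 0)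
    (htop : p = Fᶜ.card → g Fᶜ ∈ faceIdeal k F) :
    ∃ h : Finset (Fin n) → MvPolynomial (Fin n) k, ∀ B, Disjoint F B → B.card = p →
      g B = ∑ b ∈ B, sg _ b Bᶜ * (X b * h (B.erase b)) := by
  have hs : ∀ (B : Finset (Fin n)) (f : Finset (Fin n) → MvPolynomial (Fin n) k),
      ∑ b ∈ B, sg _ b B * (sg _ b Finset.univ * X b * f (B.erase b)) =
        ∑ b ∈ B, sg _ b Bᶜ * (X b * f (B.erase b)) := fun B f =>
    Finset.sum_congr rfl fun b _ => by rw [sg_compl]; ring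
  have hd : ∀ B : Finset (Fin n), B ⊆ Fᶜ ↔ Disjoint F B := fun B => by
    rw [disjoint_comm]; exact le_compl_iff_disjoint_right
  obtain ⟨h, hh⟩ := koszul_exact_unit_mul_X (fun b => sg _ b Finset.univ) (fun b => isUnit_sg _ _)
    Fᶜ p g (fun B hB hp => by rw [hs]; exact hg B ((hd B).1 hB) hp) htop
  exact ⟨h, fun B hB hp => by rw [hh B ((hd B).2 hB) hp, hs]⟩

/-- Koszul exactness in the form used for the columns of the resolution. -/
lemma koszul_exact_chain (F : Finset (Fin n)) (p : ℕ)
    (g : Finset (Fin n) → MvPolynomial (Fin n) k)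
    (hg : ∀ B, Disjoint F B → B.card + 1 = p →
      ∑ b ∈ (F ∪ B)ᶜ, sg _ b (insert b B)ᶜ * (X b * g (insert b B)) = 0)
    (htop : p = 0 → g ∅ ∈ faceIdeal k F) :
    ∃ h : Finset (Fin n) → MvPolynomial (Fin n) k, ∀ B, Disjoint F B → B.card = p →
      g B = ∑ b ∈ (F ∪ B)ᶜ, sg _ b (insert b B)ᶜ * (X b * h (insert b B)) := by
  by_cases hpU : Fᶜ.card < p
  · refine ⟨0, fun B hB hp => ?_⟩
    have := Finset.card_le_card (le_compl_iff_disjoint_left.2 hB)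
    omega
  have hs : ∀ (N : Finset (Fin n)) (f : Finset (Fin n) → MvPolynomial (Fin n) k), N ⊆ Fᶜ →
      ∑ b ∈ N, sg _ b N * (sg _ b F * X b * f (Fᶜ \ (N.erase b))) =
        ∑ b ∈ (F ∪ (Fᶜ \ N))ᶜ, sg _ b (insert b (Fᶜ \ N))ᶜ * (X b * f (insert b (Fᶜ \ N))) := by
    intro N f hN
    have e : (F ∪ (Fᶜ \ N))ᶜ = N := by
      ext x
      have := @hN x
      simp only [Finset.mem_compl, Finset.mem_union, Finset.mem_sdiff] at this ⊢
      tauto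
    rw [e]
    refine Finset.sum_congr rfl fun b hb => ?_
    have hbF : b ∉ F := by simpa using hN hb
    have e1 : Fᶜ \ N.erase b = insert b (Fᶜ \ N) := by
      ext x
      simp only [Finset.mem_compl, Finset.mem_insert, Finset.mem_sdiff, Finset.mem_erase]
      by_cases hx : x = b
      · subst hx; tauto
      · tauto
    have e2 : (insert b (Fᶜ \ N))ᶜ = F ∪ N.erase b := by
      rw [← e1]
      ext x
      have := @hN x
      simp only [Finset.mem_compl, Finset.mem_union, Finset.mem_sdiff, Finset.mem_erase] at this ⊢
      tauto
    have hdis : Disjoint F (N.erase b) :=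
      disjoint_comm.1 (le_compl_iff_disjoint_right.1 ((Finset.erase_subset _ _).trans hN))
    rw [e1, e2, sg_union b hdis, sg_erase_self]
    ring
  have hd : ∀ N : Finset (Fin n), Disjoint F (Fᶜ \ N) := fun N =>
    Finset.disjoint_left.2 fun x hx hx' => by simp_all
  obtain ⟨h, hh⟩ := koszul_exact_unit_mul_X (fun b => sg _ b F) (fun b => isUnit_sg _ _)
    Fᶜ (Fᶜ.card - p) (fun N => g (Fᶜ \ N)) (fun N hN hp => by
      rw [hs N g hN]
      refine hg _ (hd N) ?_
      rw [Finset.card_sdiff_of_subset hN]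
      have := Finset.card_le_card hN
      omega) (fun hp => by
      rw [Finset.sdiff_self]
      exact htop (by omega))
  refine ⟨fun B => h (Fᶜ \ B), fun B hB hp => ?_⟩
  have hBF : B ⊆ Fᶜ := le_compl_iff_disjoint_left.2 hB
  have e := hh (Fᶜ \ B) Finset.sdiff_subset (by rw [Finset.card_sdiff_of_subset hBF, hp])
  have hBB : Fᶜ \ (Fᶜ \ B) = B := Finset.sdiff_sdiff_eq_self hBF
  simp only [hBB] at e
  rw [e]
  have := hs (Fᶜ \ B) (fun B => h (Fᶜ \ B)) Finset.sdiff_subset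
  simp only [hBB] at this
  rw [← this]
  refine Finset.sum_congr rfl fun b hb => ?_
  rw [Finset.sdiff_sdiff_eq_self ((Finset.erase_subset _ _).trans Finset.sdiff_subset)]

end Monomial

section Totalization

open scoped Classical in
/-- The differential of the total complex dualizing `chainD`. -/
noncomputable def cochainD (k : Type) [Field k] {n : ℕ} (K : Set (Finset (Fin n))) :
    (Finset (Fin n) → Finset (Fin n) → MvPolynomial (Fin n) k) →ₗ[MvPolynomial (Fin n) k]
      Finset (Fin n) → Finset (Fin n) → MvPolynomial (Fin n) k where
  toFun g F B := ∑ b ∈ B, sg _ b Bᶜ *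
    (X b * g F (B.erase b) - if insert b F ∈ K then g (insert b F) (B.erase b) else 0)
  map_add' g h := by
    funext F B
    simp only [Pi.add_apply, ← Finset.sum_add_distrib]
    refine Finset.sum_congr rfl fun b _ => ?_
    split_ifs <;> ring
  map_smul' s g := by
    funext F B
    simp only [Pi.smul_apply, smul_eq_mul, Finset.mul_sum, RingHom.id_apply]
    refine Finset.sum_congr rfl fun b _ => ?_
    split_ifs <;> ring

/-- The differential of the total complex resolving the Stanley–Reisner ring: the row of `F` is
a Koszul complex on the variables outside `F`. -/
noncomputable def chainD (k : Type) [Field k] (n : ℕ) :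
    (Finset (Fin n) → Finset (Fin n) → MvPolynomial (Fin n) k) →ₗ[MvPolynomial (Fin n) k]
      Finset (Fin n) → Finset (Fin n) → MvPolynomial (Fin n) k where
  toFun φ F B := ∑ b ∈ (F ∪ B)ᶜ, sg _ b (insert b B)ᶜ * (X b * φ F (insert b B)) -
    ∑ f ∈ F, sg _ f (insert f B)ᶜ * φ (F.erase f) (insert f B)
  map_add' g h := by
    funext F B
    simp only [Pi.add_apply, mul_add, Finset.sum_add_distrib]
    ring
  map_smul' s g := by
    funext F B
    simp only [Pi.smul_apply, smul_eq_mul, RingHom.id_apply, mul_sub, Finset.mul_sum]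
    congr 1 <;> exact Finset.sum_congr rfl fun b _ => by ring

variable {k : Type} [Field k] {n : ℕ} {K : Set (Finset (Fin n))}

open scoped Classical in
lemma cochainD_apply (g : Finset (Fin n) → Finset (Fin n) → MvPolynomial (Fin n) k)
    (F B : Finset (Fin n)) : cochainD k K g F B = ∑ b ∈ B, sg _ b Bᶜ *
      (X b * g F (B.erase b) - if insert b F ∈ K then g (insert b F) (B.erase b) else 0) := by
  rfl

lemma chainD_apply (φ : Finset (Fin n) → Finset (Fin n) → MvPolynomial (Fin n) k)
    (F B : Finset (Fin n)) : chainD k n φ F B =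
      ∑ b ∈ (F ∪ B)ᶜ, sg _ b (insert b B)ᶜ * (X b * φ F (insert b B)) -
        ∑ f ∈ F, sg _ f (insert f B)ᶜ * φ (F.erase f) (insert f B) := rfl

lemma sum_sum_erase_eq_zero {ι M : Type*} [DecidableEq ι] [AddCommGroup M] (B : Finset ι)
    (θ : ι → ι → M) (h : ∀ b ∈ B, ∀ c ∈ B, b ≠ c → θ b c = - θ c b) :
    ∑ b ∈ B, ∑ c ∈ B.erase b, θ b c = 0 := by
  rw [Finset.sum_sigma']
  refine Finset.sum_involution (fun x _ => ⟨x.2, x.1⟩) ?_ ?_ ?_ ?_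
  · rintro ⟨b, c⟩ hx
    simp only [Finset.mem_sigma, Finset.mem_erase] at hx
    simp [h b hx.1 c hx.2.2 hx.2.1.symm]
  · rintro ⟨b, c⟩ hx _ he
    simp only [Finset.mem_sigma, Finset.mem_erase] at hx
    simp only [Sigma.mk.injEq] at he
    exact hx.2.1 he.1
  · rintro ⟨b, c⟩ hx
    simp only [Finset.mem_sigma, Finset.mem_erase] at hx ⊢
    exact ⟨hx.2.2, hx.2.1.symm, hx.1⟩
  · rintro ⟨b, c⟩ hx
    rfl

lemma sg_mul_sg_erase {R : Type} [CommRing R] {B : Finset (Fin n)} {b c : Fin n} (hb : b ∈ B)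
    (hc : c ∈ B) (h : b ≠ c) :
    sg R b Bᶜ * sg R c (B.erase b)ᶜ = - (sg R c Bᶜ * sg R b (B.erase c)ᶜ) := by
  rw [Finset.compl_erase, Finset.compl_erase]
  rcases lt_or_gt_of_ne h with h | h
  · rw [sg_insert_of_lt h (by simpa), sg_insert_of_le h.le (by simpa)]
    ring
  · rw [sg_insert_of_le h.le (by simpa), sg_insert_of_lt h (by simpa)]
    ring

lemma cochainD_cochainD (hK : IsComplex K)
    (g : Finset (Fin n) → Finset (Fin n) → MvPolynomial (Fin n) k) (F B : Finset (Fin n)) :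
    cochainD k K (cochainD k K g) F B = 0 := by
  classical
  have hdown : ∀ b c, insert c (insert b F) ∈ K → insert b F ∈ K := fun b c h =>
    hK.2 _ h _ (Finset.subset_insert _ _)
  rw [cochainD_apply]
  refine Eq.trans ?_ (sum_sum_erase_eq_zero B (fun b c =>
    sg (MvPolynomial (Fin n) k) b Bᶜ * sg _ c (B.erase b)ᶜ *
      (X b * X c * g F ((B.erase b).erase c)
      - X b * (if insert c F ∈ K then g (insert c F) ((B.erase b).erase c) else 0)
      - X c * (if insert b F ∈ K then g (insert b F) ((B.erase b).erase c) else 0)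
      + if insert c (insert b F) ∈ K then g (insert c (insert b F)) ((B.erase b).erase c)
        else 0)) ?_)
  · refine Finset.sum_congr rfl fun b _ => ?_
    rw [cochainD_apply, cochainD_apply, Finset.mul_sum]
    by_cases hb : insert b F ∈ K
    · rw [if_pos hb, ← Finset.sum_sub_distrib, Finset.mul_sum]
      refine Finset.sum_congr rfl fun c _ => ?_
      rw [if_pos hb]
      ring
    · rw [if_neg hb, sub_zero, Finset.mul_sum]
      refine Finset.sum_congr rfl fun c _ => ?_
      rw [if_neg hb, if_neg fun h => hb (hdown b c h)]
      ring
  · intro b hb c hc h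
    rw [sg_mul_sg_erase hb hc h, Finset.erase_right_comm, Finset.insert_comm c b F]
    ring

open scoped Classical in
/-- `chainD` and `cochainD` are adjoint for the pairing over the valid index pairs. -/
lemma sum_chainD_mul (hK : IsComplex K)
    (φ ψ : Finset (Fin n) → Finset (Fin n) → MvPolynomial (Fin n) k) :
    ∑ q : Finset (Fin n) × Finset (Fin n) with q.1 ∈ K ∧ Disjoint q.1 q.2,
        chainD k n φ q.1 q.2 * ψ q.1 q.2 =
      ∑ q : Finset (Fin n) × Finset (Fin n) with q.1 ∈ K ∧ Disjoint q.1 q.2,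
        φ q.1 q.2 * cochainD k K ψ q.1 q.2 := by
  have e1 : ∀ q : Finset (Fin n) × Finset (Fin n), chainD k n φ q.1 q.2 * ψ q.1 q.2 =
      ∑ b ∈ (q.1 ∪ q.2)ᶜ, sg _ b (insert b q.2)ᶜ * (X b * φ q.1 (insert b q.2)) * ψ q.1 q.2 -
        ∑ f ∈ q.1, sg _ f (insert f q.2)ᶜ * φ (q.1.erase f) (insert f q.2) * ψ q.1 q.2 :=
    fun q => by rw [chainD_apply, sub_mul, Finset.sum_mul, Finset.sum_mul]
  have e2 : ∀ q : Finset (Fin n) × Finset (Fin n), φ q.1 q.2 * cochainD k K ψ q.1 q.2 =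
      ∑ b ∈ q.2, sg _ b q.2ᶜ * X b * φ q.1 q.2 * ψ q.1 (q.2.erase b) -
        ∑ b ∈ q.2 with insert b q.1 ∈ K, sg _ b q.2ᶜ * φ q.1 q.2 *
          ψ (insert b q.1) (q.2.erase b) := fun q => by
    rw [cochainD_apply, Finset.mul_sum, Finset.sum_filter, ← Finset.sum_sub_distrib]
    refine Finset.sum_congr rfl fun b _ => ?_
    split_ifs <;> ring
  simp_rw [e1, e2, Finset.sum_sub_distrib, Finset.sum_sigma']
  congr 1
  · refine Finset.sum_bij' (fun x _ => ⟨(x.1.1, insert x.2 x.1.2), x.2⟩)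
      (fun x _ => ⟨(x.1.1, x.1.2.erase x.2), x.2⟩) ?_ ?_ ?_ ?_ ?_
    · rintro ⟨⟨F, B⟩, b⟩ hx
      simp only [Finset.mem_sigma, Finset.mem_filter, Finset.mem_univ, true_and,
        Finset.mem_compl, Finset.mem_union, not_or] at hx ⊢
      simp [hx]
    · rintro ⟨⟨F, B⟩, b⟩ hx
      simp only [Finset.mem_sigma, Finset.mem_filter, Finset.mem_univ, true_and,
        Finset.mem_compl, Finset.mem_union, not_or] at hx ⊢
      exact ⟨⟨hx.1.1, hx.1.2.mono_right (Finset.erase_subset _ _)⟩,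
        Finset.disjoint_right.1 hx.1.2 hx.2, Finset.notMem_erase _ _⟩
    · rintro ⟨⟨F, B⟩, b⟩ hx
      simp only [Finset.mem_sigma, Finset.mem_filter, Finset.mem_univ, true_and,
        Finset.mem_compl, Finset.mem_union, not_or] at hx
      simp [Finset.erase_insert hx.2.2]
    · rintro ⟨⟨F, B⟩, b⟩ hx
      simp only [Finset.mem_sigma, Finset.mem_filter, Finset.mem_univ, true_and] at hx
      simp [Finset.insert_erase hx.2]
    · rintro ⟨⟨F, B⟩, b⟩ hx
      simp only [Finset.mem_sigma, Finset.mem_filter, Finset.mem_univ, true_and,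
        Finset.mem_compl, Finset.mem_union, not_or] at hx
      simp only [Finset.erase_insert hx.2.2]
      ring
  · refine Finset.sum_bij' (fun x _ => ⟨(x.1.1.erase x.2, insert x.2 x.1.2), x.2⟩)
      (fun x _ => ⟨(insert x.2 x.1.1, x.1.2.erase x.2), x.2⟩) ?_ ?_ ?_ ?_ ?_
    · rintro ⟨⟨F, B⟩, b⟩ hx
      simp only [Finset.mem_sigma, Finset.mem_filter, Finset.mem_univ, true_and] at hx ⊢
      rw [Finset.insert_erase hx.2]
      exact ⟨⟨hK.2 _ hx.1.1 _ (Finset.erase_subset _ _), Finset.disjoint_insert_right.2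
        ⟨Finset.notMem_erase _ _, hx.1.2.mono_left (Finset.erase_subset _ _)⟩⟩,
        Finset.mem_insert_self _ _, hx.1.1⟩
    · rintro ⟨⟨F, B⟩, b⟩ hx
      simp only [Finset.mem_sigma, Finset.mem_filter, Finset.mem_univ, true_and] at hx ⊢
      exact ⟨⟨hx.2.2, Finset.disjoint_insert_left.2
        ⟨Finset.notMem_erase _ _, hx.1.2.mono_right (Finset.erase_subset _ _)⟩⟩,
        Finset.mem_insert_self _ _⟩
    · rintro ⟨⟨F, B⟩, b⟩ hx
      simp only [Finset.mem_sigma, Finset.mem_filter, Finset.mem_univ, true_and] at hx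
      simp [Finset.erase_insert (Finset.disjoint_left.1 hx.1.2 hx.2), Finset.insert_erase hx.2]
    · rintro ⟨⟨F, B⟩, b⟩ hx
      simp only [Finset.mem_sigma, Finset.mem_filter, Finset.mem_univ, true_and] at hx
      simp [Finset.erase_insert (Finset.disjoint_right.1 hx.1.2 hx.2.1),
        Finset.insert_erase hx.2.1]
    · rintro ⟨⟨F, B⟩, b⟩ hx
      simp only [Finset.mem_sigma, Finset.mem_filter, Finset.mem_univ, true_and] at hx
      simp only [Finset.erase_insert (Finset.disjoint_left.1 hx.1.2 hx.2),
        Finset.insert_erase hx.2]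

/-- Successive correction along a filtration. -/
lemma exists_filtration_eq_zero {A A' : Type*} [AddCommGroup A] [AddCommGroup A'] (D : A →+ A')
    (Q : A' → Prop) (P : A → Prop) (hP0 : P 0) (hP : ∀ a b, P a → P b → P (a + b))
    (Z : ℕ → A' → Prop) (h0 : ∀ φ, Z 0 φ)
    (hstep : ∀ r φ, Q φ → Z r φ → ∃ w, P w ∧ Q (φ - D w) ∧ Z (r + 1) (φ - D w)) (r : ℕ) :
    ∀ φ, Q φ → ∃ w, P w ∧ Q (φ - D w) ∧ Z r (φ - D w) := by
  induction r with
  | zero => exact fun φ hφ => ⟨0, hP0, by simpa using hφ, h0 _⟩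
  | succ r ih =>
    intro φ hφ
    obtain ⟨w, hw, hQ, hZ⟩ := ih φ hφ
    obtain ⟨w', hw', hQ', hZ'⟩ := hstep r _ hQ hZ
    refine ⟨w + w', hP _ _ hw hw', ?_⟩
    rw [map_add, ← sub_sub]
    exact ⟨hQ', hZ'⟩

lemma chainD_chainD (hK : IsComplex K)
    (φ : Finset (Fin n) → Finset (Fin n) → MvPolynomial (Fin n) k) {F B : Finset (Fin n)}
    (hF : F ∈ K) (hB : Disjoint F B) : chainD k n (chainD k n φ) F B = 0 := by
  classical
  have key : ∀ f : Finset (Fin n) → Finset (Fin n) → MvPolynomial (Fin n) k, f F B =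
      ∑ q : Finset (Fin n) × Finset (Fin n) with q.1 ∈ K ∧ Disjoint q.1 q.2,
        f q.1 q.2 * (Pi.single F (Pi.single B 1) : Finset (Fin n) → Finset (Fin n) → _) q.1 q.2 := by
    intro f
    rw [Finset.sum_eq_single (F, B)]
    · simp
    · rintro ⟨G, C⟩ - h
      by_cases hG : G = F
      · subst hG
        have : C ≠ B := by rintro rfl; exact h rfl
        simp [this]
      · simp [hG]
    · intro h
      exact absurd (by simpa using ⟨hF, hB⟩) h
  rw [key (chainD k n (chainD k n φ)), sum_chainD_mul hK, sum_chainD_mul hK]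
  simp [cochainD_cochainD hK]

/-- Exactness of the total complex, given exactness of its columns. -/
lemma exists_eq_chainD (p : ℕ)
    (Q : (Finset (Fin n) → Finset (Fin n) → MvPolynomial (Fin n) k) → Prop)
    (hQ : ∀ φ w, Q φ → Q (φ - chainD k n w))
    (hcol : ∀ φ, Q φ → ∀ F ∈ K, (∀ G ∈ K, G.card < F.card → ∀ B, Disjoint G B → B.card = p →
      φ G B = 0) → ∃ h : Finset (Fin n) → MvPolynomial (Fin n) k, ∀ B, Disjoint F B →
        B.card = p → φ F B = ∑ b ∈ (F ∪ B)ᶜ, sg _ b (insert b B)ᶜ * (X b * h (insert b B)))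
    (φ : Finset (Fin n) → Finset (Fin n) → MvPolynomial (Fin n) k) (hφ : Q φ) :
    ∃ w, ∀ F ∈ K, ∀ B, Disjoint F B → B.card = p → φ F B = chainD k n w F B := by
  classical
  obtain ⟨w, -, -, hw⟩ := exists_filtration_eq_zero (chainD k n).toAddMonoidHom Q (fun _ => True)
    trivial (fun _ _ _ _ => trivial)
    (fun r φ => ∀ F ∈ K, F.card < r → ∀ B, Disjoint F B → B.card = p → φ F B = 0)
    (fun φ F _ h => absurd h (Nat.not_lt_zero _)) (fun r φ hφ hZ => by
      have : ∀ F, ∃ h : Finset (Fin n) → MvPolynomial (Fin n) k, F ∈ K → F.card = r →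
          ∀ B, Disjoint F B → B.card = p →
          φ F B = ∑ b ∈ (F ∪ B)ᶜ, sg _ b (insert b B)ᶜ * (X b * h (insert b B)) := by
        intro F
        by_cases hF : F ∈ K ∧ F.card = r
        · obtain ⟨h, hh⟩ := hcol φ hφ F hF.1 (fun G hG hGr => hZ G hG (hF.2 ▸ hGr))
          exact ⟨h, fun _ _ => hh⟩
        · exact ⟨0, fun h h' => absurd ⟨h, h'⟩ hF⟩
      choose h hh using this
      refine ⟨fun F => if F.card = r then h F else 0, trivial, hQ _ _ hφ, fun F hF hFr B hB hp => ?_⟩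
      have hsum : ∑ f ∈ F, sg (MvPolynomial (Fin n) k) f (insert f B)ᶜ *
          (if (F.erase f).card = r then h (F.erase f) else 0) (insert f B) = 0 := by
        refine Finset.sum_eq_zero fun f hf => ?_
        have := Finset.card_erase_lt_of_mem hf
        rw [if_neg (by omega), Pi.zero_apply, mul_zero]
      simp only [LinearMap.toAddMonoidHom_coe, Pi.sub_apply]
      rw [chainD_apply, hsum, sub_zero]
      rcases Nat.lt_succ_iff_lt_or_eq.1 hFr with h' | h'
      · rw [hZ F hF h' B hB hp]
        simp [h'.ne]
      · simp only [h', if_true]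
        rw [← hh F hF h' B hB hp, sub_self]) (n + 1) φ hφ
  refine ⟨w, fun F hF B hB hp => sub_eq_zero.1 (hw F hF ?_ B hB hp)⟩
  have := F.card_le_univ
  rw [Fintype.card_fin] at this
  omega

lemma exists_eq_chainD_succ (hK : IsComplex K) (p : ℕ)
    (φ : Finset (Fin n) → Finset (Fin n) → MvPolynomial (Fin n) k)
    (hφ : ∀ F ∈ K, ∀ B, Disjoint F B → B.card = p → chainD k n φ F B = 0) :
    ∃ w, ∀ F ∈ K, ∀ B, Disjoint F B → B.card = p + 1 → φ F B = chainD k n w F B := by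
  refine exists_eq_chainD (p + 1)
    (fun φ => ∀ F ∈ K, ∀ B, Disjoint F B → B.card = p → chainD k n φ F B = 0)
    (fun φ w hφ F hF B hB hp => ?_) (fun φ hφ F hF hlow => ?_) φ hφ
  · rw [map_sub, Pi.sub_apply, Pi.sub_apply, hφ F hF B hB hp, chainD_chainD hK w hF hB, sub_self]
  · refine koszul_exact_chain F (p + 1) (φ F) (fun B hB hp => ?_) (fun h => absurd h p.succ_ne_zero)
    have := hφ F hF B hB (Nat.succ_injective hp)
    rw [chainD_apply, sub_eq_zero] at this
    rw [this]
    refine Finset.sum_eq_zero fun f hf => ?_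
    rw [hlow _ (hK.2 _ hF _ (Finset.erase_subset _ _)) (Finset.card_erase_lt_of_mem hf), mul_zero]
    · rw [Finset.disjoint_insert_right]
      exact ⟨Finset.notMem_erase _ _, hB.mono_left (Finset.erase_subset _ _)⟩
    · rw [Finset.card_insert_of_notMem (Finset.disjoint_left.1 hB hf)]
      exact hp

/-- Exactness of the subcomplex of cochains whose top components lie in the face ideals. -/
lemma exists_eq_cochainD (hK : IsComplex K) (p : ℕ)
    (ψ : Finset (Fin n) → Finset (Fin n) → MvPolynomial (Fin n) k)
    (hψ : ∀ F ∈ K, ∀ B, Disjoint F B → B.card = p + 1 → cochainD k K ψ F B = 0)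
    (htop : ∀ F ∈ K, Fᶜ.card = p → ψ F Fᶜ ∈ faceIdeal k F) :
    ∃ w, (∀ F, Fᶜ.card < p → w F Fᶜ = 0) ∧
      ∀ F ∈ K, ∀ B, Disjoint F B → B.card = p → ψ F B = cochainD k K w F B := by
  classical
  obtain ⟨w, hw0, -, hw⟩ := exists_filtration_eq_zero (cochainD k K).toAddMonoidHom
    (fun ψ => (∀ F ∈ K, ∀ B, Disjoint F B → B.card = p + 1 → cochainD k K ψ F B = 0) ∧
      ∀ F ∈ K, Fᶜ.card = p → ψ F Fᶜ ∈ faceIdeal k F)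
    (fun w => ∀ F, Fᶜ.card < p → w F Fᶜ = 0) (fun _ _ => rfl)
    (fun a b ha hb F hF => by rw [Pi.add_apply, Pi.add_apply, ha F hF, hb F hF, add_zero])
    (fun r φ => ∀ F ∈ K, Fᶜ.card < r → ∀ B, Disjoint F B → B.card = p → φ F B = 0)
    (fun φ F _ h => absurd h (Nat.not_lt_zero _)) (fun r φ hφ hZ => by
      have hcard : ∀ (F : Finset (Fin n)) (b : Fin n), b ∉ F → (insert b F)ᶜ.card < Fᶜ.card := by
        intro F b hb
        rw [Finset.compl_insert]
        exact Finset.card_erase_lt_of_mem (by simpa using hb)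
      have : ∀ F, ∃ h : Finset (Fin n) → MvPolynomial (Fin n) k, (Fᶜ.card < p → h = 0) ∧
          (F ∈ K → Fᶜ.card = r → ∀ B, Disjoint F B → B.card = p →
          φ F B = ∑ b ∈ B, sg _ b Bᶜ * (X b * h (B.erase b))) := by
        intro F
        by_cases hFp : Fᶜ.card < p
        · refine ⟨0, fun _ => rfl, fun _ _ B hB hp => ?_⟩
          have := Finset.card_le_card (le_compl_iff_disjoint_left.2 hB)
          omega
        by_cases hF : F ∈ K ∧ Fᶜ.card = r
        · obtain ⟨h, hh⟩ := koszul_exact_cochain F p (φ F) (fun B hB hp => by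
            rw [← hφ.1 F hF.1 B hB hp, cochainD_apply]
            refine Finset.sum_congr rfl fun b hb => ?_
            have hbF := Finset.disjoint_right.1 hB hb
            split_ifs with hbK
            · rw [hZ _ hbK (hF.2 ▸ hcard F b hbF), sub_zero]
              · rw [Finset.disjoint_insert_left]
                exact ⟨Finset.notMem_erase _ _, hB.mono_right (Finset.erase_subset _ _)⟩
              · rw [Finset.card_erase_of_mem hb, hp, Nat.add_sub_cancel]
            · rw [sub_zero]) (fun h => hφ.2 F hF.1 h.symm)
          exact ⟨h, fun h => absurd h hFp, fun _ _ => hh⟩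
        · exact ⟨0, fun _ => rfl, fun h h' => absurd ⟨h, h'⟩ hF⟩
      choose h h0 hh using this
      refine ⟨fun F => if Fᶜ.card = r then h F else 0, fun F hF => ?_,
        ⟨fun F hF B hB hp => ?_, fun F hF hFp => ?_⟩, fun F hF hFr B hB hp => ?_⟩
      · by_cases hr : Fᶜ.card = r
        · simp [hr, h0 F hF]
        · simp [hr]
      · rw [map_sub, Pi.sub_apply, Pi.sub_apply, hφ.1 F hF B hB hp]
        simp only [LinearMap.toAddMonoidHom_coe]
        rw [cochainD_cochainD hK, sub_self]
      · refine Ideal.sub_mem _ (hφ.2 F hF hFp) ?_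
        simp only [LinearMap.toAddMonoidHom_coe]
        rw [cochainD_apply]
        refine Ideal.sum_mem _ fun b hb => Ideal.mul_mem_left _ _ (Ideal.sub_mem _
          (Ideal.mul_mem_right _ _ (X_mem_faceIdeal (by simpa using hb))) ?_)
        have := hcard F b (by simpa using hb)
        split_ifs
        · rw [h0 _ (by omega)]
          simp
        · simp
        · simp
      · have hsum : ∀ b ∈ B, (if insert b F ∈ K then (if (insert b F)ᶜ.card = r then
            h (insert b F) else 0) (B.erase b) else (0 : MvPolynomial (Fin n) k)) = 0 := by
          intro b hb
          have := hcard F b (Finset.disjoint_right.1 hB hb)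
          rw [if_neg (show ¬ (insert b F)ᶜ.card = r by omega), Pi.zero_apply, ite_self]
        simp only [LinearMap.toAddMonoidHom_coe, Pi.sub_apply]
        rw [cochainD_apply]
        rw [Finset.sum_congr rfl fun b hb => by rw [hsum b hb, sub_zero]]
        rcases Nat.lt_succ_iff_lt_or_eq.1 hFr with h' | h'
        · rw [hZ F hF h' B hB hp]
          simp [h'.ne]
        · simp only [h', if_true]
          rw [← hh F hF h' B hB hp, sub_self]) (n + 1) ψ ⟨hψ, htop⟩
  refine ⟨w, hw0, fun F hF B hB hp => sub_eq_zero.1 (hw F hF ?_ B hB hp)⟩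
  have := Fᶜ.card_le_univ
  rw [Fintype.card_fin] at this
  omega

end Totalization

section Resolution

variable {k : Type} [Field k] {n : ℕ} {K : Set (Finset (Fin n))}

/-- The basis of the `p`-th term of the resolution of the Stanley–Reisner ring. -/
abbrev ResIdx (K : Set (Finset (Fin n))) (p : ℕ) : Type :=
  {q : Finset (Fin n) × Finset (Fin n) // q.1 ∈ K ∧ Disjoint q.1 q.2 ∧ q.2.card = p}

/-- The `p`-th term of the resolution of the Stanley–Reisner ring. -/
abbrev ResMod (k : Type) [Field k] (K : Set (Finset (Fin n))) (p : ℕ) : Type :=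
  ResIdx K p → MvPolynomial (Fin n) k

open scoped Classical in
/-- Extension by zero. -/
noncomputable def zext (k : Type) [Field k] (K : Set (Finset (Fin n))) (p : ℕ) :
    ResMod k K p →ₗ[MvPolynomial (Fin n) k]
      Finset (Fin n) → Finset (Fin n) → MvPolynomial (Fin n) k where
  toFun φ F B := if h : F ∈ K ∧ Disjoint F B ∧ B.card = p then φ ⟨(F, B), h⟩ else 0
  map_add' g h := by
    funext F B
    simp only [Pi.add_apply]
    split_ifs <;> simp
  map_smul' s g := by
    funext F B
    simp only [Pi.smul_apply, RingHom.id_apply]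
    split_ifs <;> simp

/-- Restriction to the valid indices. -/
def resT (k : Type) [Field k] (K : Set (Finset (Fin n))) (p : ℕ) :
    (Finset (Fin n) → Finset (Fin n) → MvPolynomial (Fin n) k) →ₗ[MvPolynomial (Fin n) k]
      ResMod k K p where
  toFun φ i := φ i.1.1 i.1.2
  map_add' _ _ := rfl
  map_smul' _ _ := rfl

lemma zext_of_mem {p : ℕ} (φ : ResMod k K p) {F B : Finset (Fin n)}
    (h : F ∈ K ∧ Disjoint F B ∧ B.card = p) : zext k K p φ F B = φ ⟨(F, B), h⟩ :=
  dif_pos h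

lemma zext_of_card_ne {p : ℕ} (φ : ResMod k K p) {F B : Finset (Fin n)}
    (h : B.card ≠ p) : zext k K p φ F B = 0 :=
  dif_neg fun h' => h h'.2.2

lemma zext_resT {p : ℕ} (φ : Finset (Fin n) → Finset (Fin n) → MvPolynomial (Fin n) k)
    {F B : Finset (Fin n)} (h : F ∈ K ∧ Disjoint F B ∧ B.card = p) :
    zext k K p (resT k K p φ) F B = φ F B := by
  rw [zext_of_mem _ h]; rfl

lemma chainD_congr (hK : IsComplex K) {p : ℕ}
    {φ ψ : Finset (Fin n) → Finset (Fin n) → MvPolynomial (Fin n) k}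
    (h : ∀ F ∈ K, ∀ B, Disjoint F B → B.card = p + 1 → φ F B = ψ F B) {F B : Finset (Fin n)}
    (hF : F ∈ K) (hB : Disjoint F B) (hp : B.card = p) : chainD k n φ F B = chainD k n ψ F B := by
  rw [chainD_apply, chainD_apply]
  congr 1
  · refine Finset.sum_congr rfl fun b hb => ?_
    rw [Finset.mem_compl, Finset.mem_union, not_or] at hb
    rw [h F hF _ (Finset.disjoint_insert_right.2 ⟨hb.1, hB⟩)
      (by rw [Finset.card_insert_of_notMem hb.2, hp])]
  · refine Finset.sum_congr rfl fun f hf => ?_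
    rw [h _ (hK.2 _ hF _ (Finset.erase_subset _ _)) _ (Finset.disjoint_insert_right.2
      ⟨Finset.notMem_erase _ _, hB.mono_left (Finset.erase_subset _ _)⟩)
      (by rw [Finset.card_insert_of_notMem (Finset.disjoint_left.1 hB hf), hp])]

lemma chainD_zext_of_card_ne {p : ℕ} (φ : ResMod k K (p + 1)) {F B : Finset (Fin n)}
    (hB : Disjoint F B) (hp : B.card ≠ p) : chainD k n (zext k K (p + 1) φ) F B = 0 := by
  rw [chainD_apply, Finset.sum_eq_zero, Finset.sum_eq_zero, sub_zero]
  · intro f hf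
    rw [zext_of_card_ne, mul_zero]
    rw [Finset.card_insert_of_notMem (Finset.disjoint_left.1 hB hf)]
    omega
  · intro b hb
    rw [Finset.mem_compl, Finset.mem_union, not_or] at hb
    rw [zext_of_card_ne, mul_zero, mul_zero]
    rw [Finset.card_insert_of_notMem hb.2]
    omega

/-- The differential of the resolution. -/
noncomputable def resD (k : Type) [Field k] (K : Set (Finset (Fin n))) (p : ℕ) :
    ResMod k K (p + 1) →ₗ[MvPolynomial (Fin n) k] ResMod k K p :=
  resT k K p ∘ₗ chainD k n ∘ₗ zext k K (p + 1)

lemma resD_apply {p : ℕ} (φ : ResMod k K (p + 1)) (i : ResIdx K p) :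
    resD k K p φ i = chainD k n (zext k K (p + 1) φ) i.1.1 i.1.2 := rfl

lemma resD_resT (hK : IsComplex K) {p : ℕ}
    (φ : Finset (Fin n) → Finset (Fin n) → MvPolynomial (Fin n) k) (i : ResIdx K p) :
    resD k K p (resT k K (p + 1) φ) i = chainD k n φ i.1.1 i.1.2 := by
  rw [resD_apply]
  exact chainD_congr hK (fun F hF B hB hp => zext_resT _ ⟨hF, hB, hp⟩) i.2.1 i.2.2.1 i.2.2.2

lemma resD_comp_resD (hK : IsComplex K) (p : ℕ) : resD k K p ∘ₗ resD k K (p + 1) = 0 := by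
  refine LinearMap.ext fun φ => funext fun i => ?_
  have : resD k K (p + 1) φ = resT k K (p + 1) (chainD k n (zext k K (p + 1 + 1) φ)) := rfl
  rw [LinearMap.comp_apply, this, resD_resT hK, chainD_chainD hK _ i.2.1 i.2.2.1]
  rfl

lemma exists_resD_eq (hK : IsComplex K) (p : ℕ) (φ : ResMod k K (p + 1)) (h : resD k K p φ = 0) :
    ∃ w, resD k K (p + 1) w = φ := by
  obtain ⟨w, hw⟩ := exists_eq_chainD_succ hK p (zext k K (p + 1) φ) fun F hF B hB hp =>
    congrFun h ⟨(F, B), hF, hB, hp⟩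
  refine ⟨resT k K (p + 2) w, funext fun i => ?_⟩
  rw [resD_resT hK, ← hw _ i.2.1 _ i.2.2.1 i.2.2.2, zext_of_mem]

open scoped Classical in
/-- The pairing of two functions over the valid index pairs. -/
noncomputable def pairing (K : Set (Finset (Fin n)))
    (ψ : Finset (Fin n) → Finset (Fin n) → MvPolynomial (Fin n) k) :
    (Finset (Fin n) → Finset (Fin n) → MvPolynomial (Fin n) k) →ₗ[MvPolynomial (Fin n) k]
      MvPolynomial (Fin n) k where
  toFun φ := ∑ q : Finset (Fin n) × Finset (Fin n) with q.1 ∈ K ∧ Disjoint q.1 q.2,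
    φ q.1 q.2 * ψ q.1 q.2
  map_add' f g := by simp [add_mul, Finset.sum_add_distrib]
  map_smul' s f := by simp [Finset.mul_sum, mul_assoc]

open scoped Classical in
lemma pairing_apply (φ ψ : Finset (Fin n) → Finset (Fin n) → MvPolynomial (Fin n) k) :
    pairing K ψ φ = ∑ q : Finset (Fin n) × Finset (Fin n) with q.1 ∈ K ∧ Disjoint q.1 q.2,
      φ q.1 q.2 * ψ q.1 q.2 := rfl

lemma pairing_chainD (hK : IsComplex K)
    (φ ψ : Finset (Fin n) → Finset (Fin n) → MvPolynomial (Fin n) k) :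
    pairing K ψ (chainD k n φ) = pairing K (cochainD k K ψ) φ :=
  sum_chainD_mul hK φ ψ

lemma pairing_congr {φ φ' : Finset (Fin n) → Finset (Fin n) → MvPolynomial (Fin n) k}
    (ψ : Finset (Fin n) → Finset (Fin n) → MvPolynomial (Fin n) k)
    (h : ∀ F ∈ K, ∀ B, Disjoint F B → φ F B = φ' F B) : pairing K ψ φ = pairing K ψ φ' := by
  rw [pairing_apply, pairing_apply]
  refine Finset.sum_congr rfl fun q hq => ?_
  simp only [Finset.mem_filter, Finset.mem_univ, true_and] at hq
  rw [h _ hq.1 _ hq.2]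

open scoped Classical in
lemma pairing_zext_single {p : ℕ} (i : ResIdx K p) (x : MvPolynomial (Fin n) k)
    (ψ : Finset (Fin n) → Finset (Fin n) → MvPolynomial (Fin n) k) :
    pairing K ψ (zext k K p (Pi.single i x)) = x * ψ i.1.1 i.1.2 := by
  rw [pairing_apply, Finset.sum_eq_single i.1]
  · rw [zext_of_mem _ i.2, Pi.single_eq_same]
  · intro q hq hi
    simp only [Finset.mem_filter, Finset.mem_univ, true_and] at hq
    by_cases hp : q.2.card = p
    · rw [zext_of_mem _ ⟨hq.1, hq.2, hp⟩, Pi.single_eq_of_ne, zero_mul]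
      rintro rfl
      exact hi rfl
    · rw [zext_of_card_ne _ hp, zero_mul]
  · intro h
    exact absurd (by simpa using ⟨i.2.1, i.2.2.1⟩) h

lemma pairing_resD (hK : IsComplex K) {p : ℕ} (φ : ResMod k K (p + 1))
    (ψ : Finset (Fin n) → Finset (Fin n) → MvPolynomial (Fin n) k) :
    pairing K ψ (zext k K p (resD k K p φ)) =
      pairing K (cochainD k K ψ) (zext k K (p + 1) φ) := by
  rw [← pairing_chainD hK]
  refine pairing_congr ψ fun F hF B hB => ?_
  by_cases hp : B.card = p
  · exact zext_resT (chainD k n (zext k K (p + 1) φ)) ⟨hF, hB, hp⟩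
  · rw [zext_of_card_ne _ hp, chainD_zext_of_card_ne _ hB hp]

/-- The linear form on a term of the resolution with given values on the basis. -/
noncomputable def resForm (K : Set (Finset (Fin n))) (p : ℕ)
    (ψ : Finset (Fin n) → Finset (Fin n) → MvPolynomial (Fin n) k) :
    ResMod k K p →ₗ[MvPolynomial (Fin n) k] MvPolynomial (Fin n) k :=
  pairing K ψ ∘ₗ zext k K p

lemma resForm_eq_iff {p : ℕ} {ψ ψ' : Finset (Fin n) → Finset (Fin n) → MvPolynomial (Fin n) k} :
    resForm K p ψ = resForm K p ψ' ↔
      ∀ F ∈ K, ∀ B, Disjoint F B → B.card = p → ψ F B = ψ' F B := by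
  classical
  refine ⟨fun h F hF B hB hp => ?_, fun h => LinearMap.pi_ext fun i x => ?_⟩
  · have := LinearMap.congr_fun h (Pi.single ⟨(F, B), hF, hB, hp⟩ 1)
    rw [resForm, resForm, LinearMap.comp_apply, LinearMap.comp_apply, pairing_zext_single,
      pairing_zext_single, one_mul, one_mul] at this
    exact this
  · rw [resForm, resForm, LinearMap.comp_apply, LinearMap.comp_apply, pairing_zext_single,
      pairing_zext_single, h _ i.2.1 _ i.2.2.1 i.2.2.2]

lemma resForm_comp_resD (hK : IsComplex K) (p : ℕ)
    (ψ : Finset (Fin n) → Finset (Fin n) → MvPolynomial (Fin n) k) :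
    resForm K p ψ ∘ₗ resD k K p = resForm K (p + 1) (cochainD k K ψ) :=
  LinearMap.ext fun φ => pairing_resD hK φ ψ

lemma exists_resForm_eq {p : ℕ} (f : ResMod k K p →ₗ[MvPolynomial (Fin n) k]
    MvPolynomial (Fin n) k) : ∃ ψ, resForm K p ψ = f := by
  classical
  refine ⟨zext k K p fun i => f (Pi.single i 1), LinearMap.pi_ext fun i x => ?_⟩
  rw [resForm, LinearMap.comp_apply, pairing_zext_single, zext_of_mem _ i.2, ← smul_eq_mul,
    ← map_smul, ← Pi.single_smul, smul_eq_mul, mul_one]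

lemma resForm_zero {p : ℕ} : resForm K p (0 : Finset (Fin n) → Finset (Fin n) →
    MvPolynomial (Fin n) k) = 0 :=
  LinearMap.ext fun φ => by simp [resForm, pairing_apply]

lemma smul_resForm {p : ℕ} (s : MvPolynomial (Fin n) k)
    (ψ : Finset (Fin n) → Finset (Fin n) → MvPolynomial (Fin n) k) :
    s • resForm K p ψ = resForm K p (s • ψ) :=
  LinearMap.ext fun φ => by
    simp only [resForm, pairing_apply, LinearMap.smul_apply, LinearMap.comp_apply, smul_eq_mul,
      Finset.mul_sum, Pi.smul_apply]
    exact Finset.sum_congr rfl fun q _ => mul_left_comm _ _ _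

/-- The cochain of squarefree monomials. -/
noncomputable def monCochain (k : Type) [Field k] {n : ℕ} :
    Finset (Fin n) → Finset (Fin n) → MvPolynomial (Fin n) k :=
  fun F B => if B = ∅ then ∏ i ∈ F, X i else 0

/-- The augmentation of the resolution. -/
noncomputable def resAug (k : Type) [Field k] (K : Set (Finset (Fin n))) :
    ResMod k K 0 →ₗ[MvPolynomial (Fin n) k] MvPolynomial (Fin n) k ⧸ srIdeal k K :=
  (srIdeal k K).mkQ ∘ₗ resForm K 0 (monCochain k)

lemma prod_X_mem_srIdeal {F : Finset (Fin n)} (hF : F ∉ K) :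
    ∏ i ∈ F, (X i : MvPolynomial (Fin n) k) ∈ srIdeal k K :=
  Ideal.subset_span ⟨F, hF, rfl⟩

lemma cochainD_monCochain_mem {F B : Finset (Fin n)} (hB : Disjoint F B) :
    cochainD k K (monCochain k) F B ∈ srIdeal k K := by
  rw [cochainD_apply]
  refine Ideal.sum_mem _ fun b hb => Ideal.mul_mem_left _ _ ?_
  have hbF := Finset.disjoint_right.1 hB hb
  simp only [monCochain]
  by_cases hBb : B.erase b = ∅
  · rw [if_pos hBb, if_pos hBb, ← Finset.prod_insert hbF]
    split_ifs with h
    · simp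
    · simpa using prod_X_mem_srIdeal h
  · simp [hBb]

lemma resAug_comp_resD (hK : IsComplex K) : resAug k K ∘ₗ resD k K 0 = 0 := by
  classical
  rw [resAug, LinearMap.comp_assoc, resForm_comp_resD hK]
  refine LinearMap.pi_ext fun i x => ?_
  rw [LinearMap.comp_apply, resForm, LinearMap.comp_apply, pairing_zext_single,
    Submodule.mkQ_apply, LinearMap.zero_apply, Submodule.Quotient.mk_eq_zero]
  exact Ideal.mul_mem_left _ _ (cochainD_monCochain_mem i.2.2.1)

lemma empty_mem (hK : IsComplex K) : ∅ ∈ K :=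
  let ⟨F, hF⟩ := hK.1
  hK.2 F hF ∅ (Finset.empty_subset _)

lemma resAug_surjective (hK : IsComplex K) : Function.Surjective (resAug k K) := by
  classical
  intro y
  obtain ⟨x, rfl⟩ := Submodule.mkQ_surjective _ y
  refine ⟨Pi.single ⟨(∅, ∅), empty_mem hK, by simp, by simp⟩ x, ?_⟩
  rw [resAug, LinearMap.comp_apply, resForm, LinearMap.comp_apply, pairing_zext_single]
  simp [monCochain]

lemma coeff_eq_zero_of_mem_srIdeal (hK : IsComplex K) {f : MvPolynomial (Fin n) k}
    (hf : f ∈ srIdeal k K) {m : Fin n →₀ ℕ} (hm : m.support ∈ K) : coeff m f = 0 := by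
  have e : srIdeal k K = Ideal.span ((fun s => monomial s (1 : k)) ''
      {s | ∃ F : Finset (Fin n), F ∉ K ∧ s = ∑ i ∈ F, Finsupp.single i 1}) := by
    rw [srIdeal]
    congr 1
    ext x
    simp only [Set.mem_ofPred_eq, Set.mem_image]
    constructor
    · rintro ⟨F, hF, rfl⟩
      exact ⟨_, ⟨F, hF, rfl⟩, monomial_sum_one _ _⟩
    · rintro ⟨_, ⟨F, hF, rfl⟩, rfl⟩
      exact ⟨F, hF, monomial_sum_one _ _⟩
  rw [e, mem_ideal_span_monomial_image] at hf
  by_contra h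
  obtain ⟨_, ⟨F, hF, rfl⟩, hle⟩ := hf m (mem_support_iff.2 h)
  refine hF (hK.2 _ hm F fun i hi => ?_)
  have := hle i
  rw [Finsupp.finsetSum_apply, Finset.sum_eq_single i (fun j _ hj => by simp [hj])
    (fun h => absurd hi h), Finsupp.single_eq_same] at this
  rw [Finsupp.mem_support_iff]
  omega

/-- The exponent of a squarefree monomial. -/
noncomputable def indExp (F : Finset (Fin n)) : Fin n →₀ ℕ := ∑ i ∈ F, Finsupp.single i 1

lemma indExp_apply (F : Finset (Fin n)) (i : Fin n) : indExp F i = if i ∈ F then 1 else 0 := by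
  rw [indExp, Finsupp.finsetSum_apply]
  simp [Finsupp.single_apply]

lemma prod_X_eq (F : Finset (Fin n)) :
    ∏ i ∈ F, (X i : MvPolynomial (Fin n) k) = monomial (indExp F) 1 :=
  (monomial_sum_one _ _).symm

lemma indExp_le_iff {F : Finset (Fin n)} {m : Fin n →₀ ℕ} : indExp F ≤ m ↔ F ⊆ m.support := by
  refine ⟨fun h i hi => ?_, fun h i => ?_⟩
  · have := h i
    rw [indExp_apply, if_pos hi] at this
    rw [Finsupp.mem_support_iff]
    omega
  · rw [indExp_apply]
    split_ifs with hi
    · have := Finsupp.mem_support_iff.1 (h hi)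
      omega
    · exact Nat.zero_le _

lemma support_add_indExp {F : Finset (Fin n)} {m : Fin n →₀ ℕ} (hm : m.support ⊆ F) :
    (m + indExp F).support = F := by
  ext i
  rw [Finsupp.mem_support_iff, Finsupp.add_apply, indExp_apply]
  by_cases hi : i ∈ F
  · simp [hi]
  · have : m i = 0 := by
      by_contra h
      exact hi (hm (Finsupp.mem_support_iff.2 h))
    simp [hi, this]

lemma coeff_add_indExp_mul (F : Finset (Fin n)) (m : Fin n →₀ ℕ) (f : MvPolynomial (Fin n) k) :
    coeff (m + indExp F) (f * ∏ i ∈ F, X i) = coeff m f := by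
  rw [prod_X_eq, coeff_mul_monomial, mul_one]

lemma coeff_mul_prod_X_eq_zero {F : Finset (Fin n)} {m : Fin n →₀ ℕ} (h : ¬ F ⊆ m.support)
    (f : MvPolynomial (Fin n) k) : coeff m (f * ∏ i ∈ F, X i) = 0 := by
  rw [prod_X_eq, coeff_mul_monomial', if_neg (by rwa [indExp_le_iff])]

lemma exists_resD_eq_of_resAug (hK : IsComplex K) (φ : ResMod k K 0) (h : resAug k K φ = 0) :
    ∃ w, resD k K 0 w = φ := by
  classical
  have hmem : pairing K (monCochain k) (zext k K 0 φ) ∈ srIdeal k K := by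
    rwa [resAug, LinearMap.comp_apply, Submodule.mkQ_apply, Submodule.Quotient.mk_eq_zero] at h
  obtain ⟨w, hw⟩ := exists_eq_chainD (K := K) 0 (fun φ => pairing K (monCochain k) φ ∈ srIdeal k K)
    (fun φ w hφ => by
      rw [map_sub, pairing_chainD hK]
      refine Ideal.sub_mem _ hφ ?_
      rw [pairing_apply]
      refine Ideal.sum_mem _ fun q hq => Ideal.mul_mem_left _ _ (cochainD_monCochain_mem ?_)
      simp only [Finset.mem_filter, Finset.mem_univ, true_and] at hq
      exact hq.2)
    (fun φ hφ F hF hlow => by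
      refine koszul_exact_chain F 0 (φ F) (fun B hB hp => absurd hp (Nat.succ_ne_zero _))
        fun _ => mem_faceIdeal.2 fun m hm => ?_
      have h0 := coeff_eq_zero_of_mem_srIdeal hK hφ
        (show (m + indExp F).support ∈ K by rwa [support_add_indExp hm])
      rw [pairing_apply, coeff_sum, Finset.sum_eq_single (F, ∅)] at h0
      · simpa [monCochain, coeff_add_indExp_mul] using h0
      · rintro ⟨G, B⟩ hq hne
        simp only [Finset.mem_filter, Finset.mem_univ, true_and] at hq
        simp only [monCochain]
        by_cases hB : B = ∅
        · subst hB
          rw [if_pos rfl]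
          by_cases hGF : G ⊆ F
          · have hlt : G.card < F.card :=
              Finset.card_lt_card (hGF.ssubset_of_ne fun h => hne (by rw [h]))
            rw [hlow G hq.1 hlt ∅ hq.2 rfl, zero_mul, coeff_zero]
          · exact coeff_mul_prod_X_eq_zero (by rwa [support_add_indExp hm]) _
        · rw [if_neg hB, mul_zero, coeff_zero]
      · intro h
        exact absurd (by simpa using hF) h)
    (zext k K 0 φ) hmem
  refine ⟨resT k K 1 w, funext fun i => ?_⟩
  rw [resD_resT hK, ← hw _ i.2.1 _ i.2.2.1 i.2.2.2, zext_of_mem _ i.2]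

/-- The annihilator of `Ext^p(k[K], S)` in terms of the total complex. -/
lemma mem_annihilator_extM_srRing (hK : IsComplex K) (p : ℕ) (s : MvPolynomial (Fin n) k) :
    s ∈ Module.annihilator (MvPolynomial (Fin n) k)
        (extM (srRing k K) (ModuleCat.of _ (MvPolynomial (Fin n) k)) p) ↔
      ∀ ψ, (∀ F ∈ K, ∀ B, Disjoint F B → B.card = p + 1 → cochainD k K ψ F B = 0) →
        ∃ g, ∀ F ∈ K, ∀ B, Disjoint F B → B.card = p → s * ψ F B = cochainD k K g F B := by
  have hcoc : ∀ (p : ℕ) (ψ : Finset (Fin n) → Finset (Fin n) → MvPolynomial (Fin n) k),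
      resForm K p ψ ∘ₗ resD k K p = 0 ↔
        ∀ F ∈ K, ∀ B, Disjoint F B → B.card = p + 1 → cochainD k K ψ F B = 0 := fun p ψ => by
    rw [resForm_comp_resD hK, ← resForm_zero, resForm_eq_iff]
    rfl
  rcases p with _ | p
  · refine (mem_annihilator_extM_zero_iff (ResMod k K) (resD k K) (resD_comp_resD hK)
      (exists_resD_eq hK) _ (resAug k K) (resAug_surjective hK) (exists_resD_eq_of_resAug hK)
      (resAug_comp_resD hK) _ s).trans ⟨fun h ψ hψ => ⟨0, ?_⟩, fun h f hf => ?_⟩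
    · have := h (resForm K 0 ψ) ((hcoc 0 ψ).2 hψ)
      rw [smul_resForm, ← resForm_zero, resForm_eq_iff] at this
      rw [map_zero]
      exact this
    · obtain ⟨ψ, rfl⟩ := exists_resForm_eq f
      obtain ⟨g, hg⟩ := h ψ ((hcoc 0 ψ).1 hf)
      rw [smul_resForm, ← resForm_zero, resForm_eq_iff]
      intro F hF B hB hp
      refine (hg F hF B hB hp).trans ?_
      rw [Finset.card_eq_zero.1 hp, cochainD_apply, Finset.sum_empty]
      rfl
  · refine (mem_annihilator_extM_succ_iff (ResMod k K) (resD k K) (resD_comp_resD hK)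
      (exists_resD_eq hK) _ (resAug k K) (resAug_surjective hK) (exists_resD_eq_of_resAug hK)
      (resAug_comp_resD hK) _ p s).trans ⟨fun h ψ hψ => ?_, fun h f hf => ?_⟩
    · obtain ⟨f, hf⟩ := h (resForm K (p + 1) ψ) ((hcoc _ ψ).2 hψ)
      obtain ⟨g, rfl⟩ := exists_resForm_eq f
      rw [smul_resForm, resForm_comp_resD hK, resForm_eq_iff] at hf
      exact ⟨g, fun F hF B hB hp => (hf F hF B hB hp).symm⟩
    · obtain ⟨ψ, rfl⟩ := exists_resForm_eq f
      obtain ⟨g, hg⟩ := h ψ ((hcoc _ ψ).1 hf)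
      refine ⟨resForm K p g, ?_⟩
      rw [smul_resForm, resForm_comp_resD hK, resForm_eq_iff]
      exact fun F hF B hB hp => (hg F hF B hB hp).symm

end Resolution

section LinkHomology

variable {k : Type} [Field k] {n : ℕ} {K : Set (Finset (Fin n))}

/-- Vanishing of the homology of a complex in cardinality `c`, for chains given as functions. -/
def HomologyVanishesAt (k : Type) [Field k] (L : Set (Finset (Fin n))) (c : ℕ) : Prop :=
  ∀ z : Finset (Fin n) → k, (∀ C ∉ L, z C = 0) →
    (∀ D ∈ L, D.card + 1 = c → ∑ x ∈ Dᶜ, sg k x D * z (insert x D) = 0) →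
    ∃ w : Finset (Fin n) → k, (∀ C ∉ L, w C = 0) ∧
      ∀ C ∈ L, C.card = c → z C = ∑ x ∈ Cᶜ, sg k x C * w (insert x C)

open scoped Classical in
/-- Extension of a chain by zero. -/
noncomputable def chainFun (L : Set (Finset (Fin n))) (c : ℕ) :
    chainGroup k L c →ₗ[k] (Finset (Fin n) → k) where
  toFun z F := if h : F ∈ L ∧ F.card = c then z ⟨F, h⟩ else 0
  map_add' y z := by
    funext F
    simp only [Pi.add_apply]
    split_ifs <;> simp
  map_smul' a z := by
    funext F
    simp only [Pi.smul_apply, RingHom.id_apply]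
    split_ifs <;> simp

lemma chainFun_of_mem {L : Set (Finset (Fin n))} {c : ℕ} (z : chainGroup k L c)
    {F : Finset (Fin n)} (h : F ∈ L ∧ F.card = c) : chainFun L c z F = z ⟨F, h⟩ :=
  dif_pos h

lemma chainFun_of_notMem {L : Set (Finset (Fin n))} {c : ℕ} (z : chainGroup k L c)
    {F : Finset (Fin n)} (h : ¬ (F ∈ L ∧ F.card = c)) : chainFun L c z F = 0 :=
  dif_neg h

/-- The chain with prescribed values on the faces. -/
noncomputable def chainOf (L : Set (Finset (Fin n))) (c : ℕ) (f : Finset (Fin n) → k) :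
    chainGroup k L c :=
  Finsupp.equivFunOnFinite.symm fun F => f F.1

lemma chainOf_apply (L : Set (Finset (Fin n))) (c : ℕ) (f : Finset (Fin n) → k) (F) :
    chainOf L c f F = f F.1 := rfl

lemma boundary_apply {L : Set (Finset (Fin n))} {c : ℕ}
    (z : chainGroup k L (c + 1)) (D : {F : Finset (Fin n) // F ∈ L ∧ F.card = c}) :
    boundary k L c z D = ∑ x ∈ D.1ᶜ, sg k x D.1 * chainFun L (c + 1) z (insert x D.1) := by
  classical
  induction z using Finsupp.induction_linear with
  | zero => simp
  | add y z hy hz => simp [hy, hz, mul_add, Finset.sum_add_distrib]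
  | single F a =>
    have h1 : ∀ x : Fin n, chainFun L (c + 1) (Finsupp.single F a) (insert x D.1) =
        if insert x D.1 = F.1 then a else 0 := by
      intro x
      by_cases h : insert x D.1 = F.1
      · rw [chainFun_of_mem _ (by rw [h]; exact F.2), if_pos h, Finsupp.single_apply,
          if_pos (Subtype.ext h.symm)]
      · rw [if_neg h]
        by_cases h' : insert x D.1 ∈ L ∧ (insert x D.1).card = c + 1
        · rw [chainFun_of_mem _ h', Finsupp.single_apply, if_neg]
          exact fun e => h (congrArg Subtype.val e).symm
        · exact chainFun_of_notMem _ h'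
    have h2 : ∀ x : {x // x ∈ F.1}, ((if h : F.1.erase x.1 ∈ L then
        Finsupp.single (⟨F.1.erase x.1, h, by simp [Finset.card_erase_of_mem x.2, F.2.2]⟩ :
          {F : Finset (Fin n) // F ∈ L ∧ F.card = c})
          ((-1 : k) ^ (F.1.filter (fun y => y < x.1)).card) else 0) : chainGroup k L c) D =
        if F.1.erase x.1 = D.1 then sg k x.1 F.1 else 0 := by
      intro x
      by_cases h : F.1.erase x.1 ∈ L
      · rw [dif_pos h, Finsupp.single_apply]
        exact if_congr ⟨fun e => congrArg Subtype.val e, fun e => Subtype.ext e⟩ rfl rfl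
      · rw [dif_neg h, if_neg, Finsupp.zero_apply]
        intro e
        exact h (e ▸ D.2.1)
    rw [boundary, Finsupp.lsum_single, LinearMap.toSpanSingleton_apply, Finsupp.smul_apply,
      boundaryAt, Finsupp.finsetSum_apply, Finset.sum_congr rfl fun x _ => h2 x,
      Finset.sum_attach F.1 (fun x => if F.1.erase x = D.1 then sg k x F.1 else 0)]
    simp_rw [h1, mul_ite, mul_zero]
    rw [← Finset.sum_filter, ← Finset.sum_filter, smul_eq_mul, Finset.mul_sum]
    refine Finset.sum_congr ?_ fun x hx => ?_
    · ext x
      simp only [Finset.mem_filter, Finset.mem_compl]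
      constructor
      · rintro ⟨h, e⟩
        rw [← e]
        exact ⟨Finset.notMem_erase _ _, Finset.insert_erase h⟩
      · rintro ⟨h, e⟩
        rw [← e]
        exact ⟨Finset.mem_insert_self _ _, Finset.erase_insert h⟩
    · simp only [Finset.mem_filter, Finset.mem_compl] at hx
      rw [mul_comm, ← hx.2, sg_insert_of_le le_rfl hx.1]

lemma chainFun_chainOf {L : Set (Finset (Fin n))} {c : ℕ} {f : Finset (Fin n) → k}
    (hf : ∀ C ∉ L, f C = 0) {F : Finset (Fin n)} (h : F.card = c) :
    chainFun L c (chainOf L c f) F = f F := by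
  by_cases hF : F ∈ L
  · rw [chainFun_of_mem _ ⟨hF, h⟩, chainOf_apply]
  · rw [chainFun_of_notMem _ fun h => hF h.1, hf F hF]

lemma boundary_chainOf {L : Set (Finset (Fin n))} {c : ℕ} {f : Finset (Fin n) → k}
    (hf : ∀ C ∉ L, f C = 0) (D : {F : Finset (Fin n) // F ∈ L ∧ F.card = c}) :
    boundary k L c (chainOf L (c + 1) f) D = ∑ x ∈ D.1ᶜ, sg k x D.1 * f (insert x D.1) := by
  rw [boundary_apply]
  refine Finset.sum_congr rfl fun x hx => ?_
  rw [chainFun_chainOf hf]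
  rw [Finset.card_insert_of_notMem (by simpa using hx), D.2.2]

lemma chainFun_eq_zero {L : Set (Finset (Fin n))} {c : ℕ} (z : chainGroup k L c)
    (C : Finset (Fin n)) (hC : C ∉ L) : chainFun L c z C = 0 :=
  chainFun_of_notMem _ fun h => hC h.1

lemma homologyVanishesAt_iff {L : Set (Finset (Fin n))} {c : ℕ} :
    HomologyVanishesAt k L c ↔ ∀ z : chainGroup k L c,
      (∀ D ∈ L, D.card + 1 = c → ∑ x ∈ Dᶜ, sg k x D * chainFun L c z (insert x D) = 0) →
      ∃ b : chainGroup k L (c + 1), boundary k L c b = z := by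
  constructor
  · intro h z hz
    obtain ⟨w, hw0, hw⟩ := h (chainFun L c z) (chainFun_eq_zero z) hz
    refine ⟨chainOf L (c + 1) w, Finsupp.ext fun D => ?_⟩
    rw [boundary_chainOf hw0, ← hw D.1 D.2.1 D.2.2, chainFun_of_mem _ D.2]
  · intro h z hz0 hz
    obtain ⟨b, hb⟩ := h (chainOf L c z) fun D hD hc => by
      rw [← hz D hD hc]
      refine Finset.sum_congr rfl fun x hx => ?_
      rw [chainFun_chainOf hz0]
      rw [Finset.card_insert_of_notMem (by simpa using hx), hc]
    refine ⟨chainFun L (c + 1) b, chainFun_eq_zero b, fun C hC hc => ?_⟩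
    rw [← boundary_apply b ⟨C, hC, hc⟩, hb, chainOf_apply]

lemma reducedHomologyVanishes_iff {L : Set (Finset (Fin n))} (c : ℕ) :
    reducedHomologyVanishes k L ((c : ℤ) - 1) ↔ HomologyVanishesAt k L c := by
  rw [homologyVanishesAt_iff, reducedHomologyVanishes, if_neg (by omega)]
  rcases c with _ | c
  · rw [if_pos (by simp)]
    exact forall_congr' fun z => ⟨fun h _ => h, fun h => h fun D _ hD => absurd hD (by omega)⟩
  · rw [if_neg (by omega)]
    have e : (((c + 1 : ℕ) : ℤ) - 1).toNat = c := by omega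
    rw [e]
    refine forall_congr' fun z => imp_congr_left ⟨fun h D hD hc => ?_, fun h => ?_⟩
    · rw [← boundary_apply z ⟨D, hD, Nat.succ_injective hc⟩, h, Finsupp.zero_apply]
    · ext D
      rw [boundary_apply, Finsupp.zero_apply]
      exact h D.1 D.2.1 (by rw [D.2.2])

end LinkHomology

section Annihilator

variable {k : Type} [Field k] {n : ℕ} {K : Set (Finset (Fin n))}

lemma mem_link {F C : Finset (Fin n)} : C ∈ link K F ↔ F ∪ C ∈ K ∧ Disjoint F C := by
  rw [Finset.union_comm, disjoint_comm, Finset.disjoint_iff_inter_eq_empty]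
  rfl

/-- The sign comparing the orientation of `F ∪ C` with that of `C`. -/
def linkSg (k : Type) [Field k] (F C : Finset (Fin n)) : k := ∏ x ∈ C, sg k x F

lemma linkSg_mul_self (F C : Finset (Fin n)) : linkSg k F C * linkSg k F C = 1 := by
  rw [linkSg, ← Finset.prod_mul_distrib]
  exact Finset.prod_eq_one fun x _ => sg_mul_self x F

lemma linkSg_insert (F : Finset (Fin n)) {C : Finset (Fin n)} {b : Fin n} (hb : b ∉ C) :
    linkSg k F (insert b C) = sg k b F * linkSg k F C :=
  Finset.prod_insert hb

lemma coeff_sg_mul (b : Fin n) (A : Finset (Fin n)) (m : Fin n →₀ ℕ) (f : MvPolynomial (Fin n) k) :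
    coeff m (sg _ b A * f) = sg k b A * coeff m f := by
  rw [← map_sg (C : k →+* MvPolynomial (Fin n) k), coeff_C_mul]

open scoped Classical in
/-- The chain on the link of `F` formed by the coefficients of a monomial in the top components
of a cochain. -/
noncomputable def linkPart (K : Set (Finset (Fin n))) (F : Finset (Fin n)) (m : Fin n →₀ ℕ)
    (g : Finset (Fin n) → Finset (Fin n) → MvPolynomial (Fin n) k) (C : Finset (Fin n)) : k :=
  if C ∈ link K F then linkSg k F C * coeff m (g (F ∪ C) (F ∪ C)ᶜ) else 0

lemma linkPart_of_mem {F C : Finset (Fin n)} (h : C ∈ link K F) (m : Fin n →₀ ℕ)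
    (g : Finset (Fin n) → Finset (Fin n) → MvPolynomial (Fin n) k) :
    linkPart K F m g C = linkSg k F C * coeff m (g (F ∪ C) (F ∪ C)ᶜ) := if_pos h

lemma linkPart_of_notMem {F C : Finset (Fin n)} (h : C ∉ link K F) (m : Fin n →₀ ℕ)
    (g : Finset (Fin n) → Finset (Fin n) → MvPolynomial (Fin n) k) :
    linkPart K F m g C = 0 := if_neg h

open scoped Classical in
lemma coeff_cochainD_compl {F : Finset (Fin n)} {m : Fin n →₀ ℕ} (hm : m.support ⊆ F)
    (g : Finset (Fin n) → Finset (Fin n) → MvPolynomial (Fin n) k) :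
    coeff m (cochainD k K g F Fᶜ) = - ∑ b ∈ Fᶜ, sg k b F *
      if insert b F ∈ K then coeff m (g (insert b F) (insert b F)ᶜ) else 0 := by
  rw [cochainD_apply, coeff_sum, ← Finset.sum_neg_distrib]
  refine Finset.sum_congr rfl fun b hb => ?_
  have hX : coeff m (X b * g F (Fᶜ.erase b)) = 0 :=
    mem_faceIdeal.1 (Ideal.mul_mem_right _ _ (X_mem_faceIdeal (by simpa using hb))) m hm
  rw [compl_compl, coeff_sg_mul, coeff_sub, hX, zero_sub, mul_neg, Finset.compl_insert]
  split_ifs <;> simp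

lemma linkPart_cochainD {F C : Finset (Fin n)} (hC : C ∈ link K F) {m : Fin n →₀ ℕ}
    (hm : m.support ⊆ F) (g : Finset (Fin n) → Finset (Fin n) → MvPolynomial (Fin n) k) :
    linkPart K F m (cochainD k K g) C =
      - ∑ b ∈ Cᶜ, sg k b C * linkPart K F m g (insert b C) := by
  have hd := (mem_link.1 hC).2
  rw [linkPart_of_mem hC, coeff_cochainD_compl (hm.trans Finset.subset_union_left), mul_neg,
    Finset.mul_sum, neg_inj]
  refine Finset.sum_subset_zero_on_sdiff
    (Finset.compl_subset_compl.2 Finset.subset_union_right) ?_ ?_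
  · intro b hb
    simp only [Finset.mem_sdiff, Finset.mem_compl, Finset.mem_union, not_or, not_and, not_not]
      at hb
    have hbF : b ∈ F := by
      by_contra h
      exact hb.1 (hb.2 h)
    rw [linkPart_of_notMem, mul_zero]
    exact fun h => Finset.disjoint_left.1 (mem_link.1 h).2 hbF (Finset.mem_insert_self _ _)
  · intro b hb
    simp only [Finset.mem_compl, Finset.mem_union, not_or] at hb
    by_cases hbK : insert b (F ∪ C) ∈ K
    · have hmem : insert b C ∈ link K F := mem_link.2 ⟨by rwa [Finset.union_insert],
        Finset.disjoint_insert_right.2 ⟨hb.1, hd⟩⟩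
      rw [if_pos hbK, linkPart_of_mem hmem, linkSg_insert F hb.2, Finset.union_insert,
        sg_union b hd]
      ring
    · rw [if_neg hbK, linkPart_of_notMem, mul_zero, mul_zero, mul_zero]
      intro h
      rw [mem_link, Finset.union_insert] at h
      exact hbK h.1

/-- Nonvanishing homology of the link of `F` confines the annihilator to the face ideal. -/
lemma annihilator_extM_srRing_le (hK : IsComplex K) {p c : ℕ} {F₀ : Finset (Fin n)}
    (hc : F₀.card + c + p = n) (hne : ¬ HomologyVanishesAt k (link K F₀) c) :
    Module.annihilator (MvPolynomial (Fin n) k)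
      (extM (srRing k K) (ModuleCat.of _ (MvPolynomial (Fin n) k)) p) ≤ faceIdeal k F₀ := by
  classical
  intro s hs
  by_contra hsF
  apply hne
  intro z hz0 hz
  rw [mem_faceIdeal] at hsF
  push Not at hsF
  obtain ⟨a, ha, hsa⟩ := hsF
  rw [mem_annihilator_extM_srRing hK] at hs
  have hcard : ∀ F : Finset (Fin n), Fᶜ.card + F.card = n := fun F => by
    rw [Finset.card_compl, Fintype.card_fin]
    have := F.card_le_univ
    rw [Fintype.card_fin] at this
    omega
  obtain ⟨ψ, hψ⟩ : ∃ ψ : Finset (Fin n) → Finset (Fin n) → MvPolynomial (Fin n) k,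
      ∀ F, ψ F Fᶜ = if F₀ ⊆ F then
        monomial (indExp F₀) (linkSg k F₀ (F \ F₀) * z (F \ F₀)) else 0 :=
    ⟨fun F _ => _, fun F => rfl⟩
  have hind : (indExp F₀).support = F₀ := by
    simpa using support_add_indExp (m := 0) (F := F₀) (by simp)
  have hlp : ∀ C, linkPart K F₀ (indExp F₀) ψ C = z C := by
    intro C
    by_cases hC : C ∈ link K F₀
    · rw [linkPart_of_mem hC, hψ, if_pos Finset.subset_union_left, coeff_monomial, if_pos rfl,
        Finset.union_sdiff_cancel_left (mem_link.1 hC).2, ← mul_assoc, linkSg_mul_self, one_mul]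
    · rw [linkPart_of_notMem hC, hz0 C hC]
  obtain ⟨w, hw0, hw⟩ := exists_eq_cochainD hK (p + 1) (cochainD k K ψ)
    (fun F _ B _ _ => cochainD_cochainD hK ψ F B) (fun F hF hFp => mem_faceIdeal.2 fun m hm => by
      by_cases hmF : m = indExp F₀
      · subst hmF
        rw [hind] at hm
        have hC : F \ F₀ ∈ link K F₀ := mem_link.2
          ⟨by rwa [Finset.union_sdiff_of_subset hm], Finset.disjoint_sdiff⟩
        have := linkPart_cochainD hC hind.subset ψ
        simp_rw [hlp] at this
        rw [hz _ hC, neg_zero, linkPart_of_mem hC, Finset.union_sdiff_of_subset hm] at this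
        · refine (mul_eq_zero.1 this).resolve_left fun h => ?_
          have h1 := linkSg_mul_self (k := k) F₀ (F \ F₀)
          rw [h, zero_mul] at h1
          exact zero_ne_one h1
        · rw [Finset.card_sdiff_of_subset hm]
          have := hcard F
          have := Finset.card_le_card hm
          omega
      · rw [coeff_cochainD_compl hm, Finset.sum_eq_zero, neg_zero]
        intro b _
        rw [hψ]
        split_ifs
        · rw [coeff_monomial, if_neg (Ne.symm hmF), mul_zero]
        · simp
        · simp)
  obtain ⟨g, hg⟩ := hs (ψ - w) fun F hF B hB hp => by
    rw [map_sub, Pi.sub_apply, Pi.sub_apply, hw F hF B hB hp, sub_self]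
  refine ⟨fun C => - (coeff a s)⁻¹ * linkPart K F₀ (a + indExp F₀) g C,
    fun C hC => by simp only [linkPart_of_notMem hC, mul_zero], fun C hC hCc => ?_⟩
  have hCl := mem_link.1 hC
  have h1 := linkPart_cochainD hC (support_add_indExp ha).subset g
  have hcF : (F₀ ∪ C)ᶜ.card = p := by
    have := hcard (F₀ ∪ C)
    rw [Finset.card_union_of_disjoint hCl.2] at this
    omega
  rw [linkPart_of_mem hC, ← hg _ hCl.1 _ disjoint_compl_right hcF, Pi.sub_apply, Pi.sub_apply,
    hw0 _ (by omega), sub_zero, hψ, if_pos Finset.subset_union_left,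
    Finset.union_sdiff_cancel_left hCl.2, coeff_mul_monomial] at h1
  have h2 : coeff a s * z C = - ∑ b ∈ Cᶜ, sg k b C * linkPart K F₀ (a + indExp F₀) g (insert b C) := by
    rw [← h1]
    linear_combination (-(coeff a s * z C)) * linkSg_mul_self (k := k) F₀ C
  have h3 : ∑ b ∈ Cᶜ, sg k b C * (- (coeff a s)⁻¹ * linkPart K F₀ (a + indExp F₀) g (insert b C)) =
      (coeff a s)⁻¹ * - ∑ b ∈ Cᶜ, sg k b C * linkPart K F₀ (a + indExp F₀) g (insert b C) := by
    rw [mul_neg, Finset.mul_sum, ← Finset.sum_neg_distrib]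
    exact Finset.sum_congr rfl fun b _ => by ring
  rw [h3, ← h2, inv_mul_cancel_left₀ hsa]

/-- If the homology of all links of faces containing `A` vanishes in the relevant degree, the
monomial of `A` annihilates the `Ext` module. -/
lemma prod_X_mem_annihilator (hK : IsComplex K) {p j : ℕ} (hp : j + p = n) (A : Finset (Fin n))
    (hvan : ∀ F ∈ K, ∀ c, A ⊆ F → F.card + c = j → HomologyVanishesAt k (link K F) c) :
    ∏ i ∈ A, X i ∈ Module.annihilator (MvPolynomial (Fin n) k)
      (extM (srRing k K) (ModuleCat.of _ (MvPolynomial (Fin n) k)) p) := by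
  classical
  have hcard : ∀ F : Finset (Fin n), Fᶜ.card + F.card = n := fun F => by
    rw [Finset.card_compl, Fintype.card_fin]
    have := F.card_le_univ
    rw [Fintype.card_fin] at this
    omega
  rw [mem_annihilator_extM_srRing hK]
  intro ψ₀ hψ₀
  obtain ⟨ψ, hψdef⟩ : ∃ ψ, ψ = (∏ i ∈ A, X i : MvPolynomial (Fin n) k) • ψ₀ := ⟨_, rfl⟩
  have hψ : ∀ F ∈ K, ∀ B, Disjoint F B → B.card = p + 1 → cochainD k K ψ F B = 0 :=
    fun F hF B hB hp => by
      rw [hψdef, map_smul, Pi.smul_apply, Pi.smul_apply, hψ₀ F hF B hB hp, smul_zero]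
  have hψA : ∀ (m : Fin n →₀ ℕ), ¬ A ⊆ m.support → ∀ F B, coeff m (ψ F B) = 0 :=
    fun m hm F B => by
      rw [hψdef, Pi.smul_apply, Pi.smul_apply, smul_eq_mul, mul_comm]
      exact coeff_mul_prod_X_eq_zero hm _
  have hw : ∀ m : Fin n →₀ ℕ, ∃ w : Finset (Fin n) → k, (∀ C ∉ link K m.support, w C = 0) ∧
      ∀ C ∈ link K m.support, m.support.card + C.card = j →
        linkPart K m.support m ψ C = ∑ x ∈ Cᶜ, sg k x C * w (insert x C) := by
    intro m
    by_cases hm : A ⊆ m.support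
    · by_cases hmK : m.support ∈ K
      · by_cases hmj : m.support.card ≤ j
        · obtain ⟨w, hw0, hw⟩ := hvan _ hmK (j - m.support.card) hm (by omega)
            (linkPart K m.support m ψ) (fun C hC => linkPart_of_notMem hC _ _) (fun D hD hDc => by
              have h := linkPart_cochainD hD subset_rfl ψ (m := m)
              have hDl := mem_link.1 hD
              rw [linkPart_of_mem hD, hψ _ hDl.1 _ disjoint_compl_right, coeff_zero, mul_zero,
                zero_eq_neg] at h
              · exact h
              · have := hcard (m.support ∪ D)
                rw [Finset.card_union_of_disjoint hDl.2] at this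
                omega)
          exact ⟨w, hw0, fun C hC hCj => hw C hC (by omega)⟩
        · exact ⟨0, fun _ _ => rfl, fun C _ h => by omega⟩
      · refine ⟨0, fun _ _ => rfl, fun C hC _ => absurd ?_ hmK⟩
        exact hK.2 _ (mem_link.1 hC).1 _ Finset.subset_union_left
    · refine ⟨0, fun _ _ => rfl, fun C hC _ => ?_⟩
      rw [linkPart_of_mem hC, hψA m hm]
      simp
  choose w hw0 hw using hw
  obtain ⟨M, hM⟩ : ∃ M : Finset (Fin n →₀ ℕ), ∀ m ∉ M, ∀ F, coeff m (ψ F Fᶜ) = 0 :=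
    ⟨Finset.univ.biUnion fun F => (ψ F Fᶜ).support, fun m hm F => by
      simpa using fun h => hm (Finset.mem_biUnion.2 ⟨F, Finset.mem_univ _, h⟩)⟩
  obtain ⟨χ, hχ⟩ : ∃ χ : Finset (Fin n) → Finset (Fin n) → MvPolynomial (Fin n) k,
      ∀ m F, coeff m (χ F Fᶜ) = if m ∈ M then
        - (linkSg k m.support (F \ m.support) * w m (F \ m.support)) else 0 :=
    ⟨fun F _ => ∑ m ∈ M, monomial m (- (linkSg k m.support (F \ m.support) *
      w m (F \ m.support))), fun m F => by
        rw [coeff_sum]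
        simp only [coeff_monomial]
        exact Finset.sum_ite_eq' M m _⟩
  obtain ⟨v, -, hv⟩ := exists_eq_cochainD hK p (ψ - cochainD k K χ) (fun F hF B hB hp => by
    rw [map_sub, Pi.sub_apply, Pi.sub_apply, hψ F hF B hB hp, cochainD_cochainD hK, sub_zero])
    (fun F hF hFp => mem_faceIdeal.2 fun m hm => by
      rw [Pi.sub_apply, Pi.sub_apply, coeff_sub, sub_eq_zero]
      by_cases hmM : m ∈ M
      · have hC : F \ m.support ∈ link K m.support := mem_link.2
          ⟨by rwa [Finset.union_sdiff_of_subset hm], Finset.disjoint_sdiff⟩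
        have hlp : ∀ C, linkPart K m.support m χ C = - w m C := by
          intro C
          by_cases hC : C ∈ link K m.support
          · rw [linkPart_of_mem hC, hχ, if_pos hmM,
              Finset.union_sdiff_cancel_left (mem_link.1 hC).2, mul_neg, ← mul_assoc,
              linkSg_mul_self, one_mul]
          · rw [linkPart_of_notMem hC, hw0 m C hC, neg_zero]
        have h1 := linkPart_cochainD hC subset_rfl χ
        simp only [hlp, mul_neg, Finset.sum_neg_distrib, neg_neg] at h1
        rw [← hw m _ hC, linkPart_of_mem hC, linkPart_of_mem hC,
          Finset.union_sdiff_of_subset hm] at h1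
        · have h2 := congrArg (linkSg k m.support (F \ m.support) * ·) h1
          simp only [← mul_assoc, linkSg_mul_self, one_mul] at h2
          exact h2.symm
        · rw [Finset.card_sdiff_of_subset hm]
          have := hcard F
          have := Finset.card_le_card hm
          omega
      · rw [hM m hmM, coeff_cochainD_compl hm, Finset.sum_eq_zero, neg_zero]
        intro b _
        rw [hχ, if_neg hmM, ite_self, mul_zero])
  refine ⟨v + χ, fun F hF B hB hp => ?_⟩
  rw [map_add, Pi.add_apply, Pi.add_apply, ← hv F hF B hB hp, Pi.sub_apply, Pi.sub_apply,
    sub_add_cancel, hψdef]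
  rfl

end Annihilator

section Dimension

variable {k : Type} [Field k] {n : ℕ} {K : Set (Finset (Fin n))}

/-- The projection killing the variables outside `F`. -/
noncomputable def faceProj (k : Type) [Field k] (F : Finset (Fin n)) :
    MvPolynomial (Fin n) k →ₐ[k] MvPolynomial F k :=
  aeval fun i => if h : i ∈ F then X ⟨i, h⟩ else 0

lemma faceProj_surjective (F : Finset (Fin n)) : Function.Surjective (faceProj k F) := by
  have : (faceProj k F).comp (rename ((↑) : F → Fin n)) = AlgHom.id k _ :=
    algHom_ext fun i => by simp [faceProj]
  exact fun f => ⟨rename _ f, AlgHom.congr_fun this f⟩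

lemma faceProj_eq_zero {F : Finset (Fin n)} {f : MvPolynomial (Fin n) k} (hf : f ∈ faceIdeal k F) :
    faceProj k F f = 0 := by
  have : faceIdeal k F ≤ RingHom.ker (faceProj k F) := by
    rw [faceIdeal, Ideal.span_le]
    rintro _ ⟨i, hi, rfl⟩
    have hi' : i ∉ F := by simpa using hi
    simp [faceProj, hi']
  exact this hf

lemma ringKrullDim_mvPolynomial_face (F : Finset (Fin n)) :
    ringKrullDim (MvPolynomial F k) = F.card := by
  rw [MvPolynomial.ringKrullDim_of_isNoetherianRing, ringKrullDim_eq_zero_of_field, zero_add,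
    Nat.card_eq_fintype_card, Fintype.card_coe]

lemma card_le_ringKrullDim {I : Ideal (MvPolynomial (Fin n) k)} {F : Finset (Fin n)}
    (h : I ≤ faceIdeal k F) : (F.card : WithBot ℕ∞) ≤ ringKrullDim (MvPolynomial (Fin n) k ⧸ I) := by
  rw [← ringKrullDim_mvPolynomial_face (k := k)]
  exact ringKrullDim_le_of_surjective
    (Ideal.Quotient.lift I (faceProj k F : MvPolynomial (Fin n) k →+* MvPolynomial F k)
      fun f hf => faceProj_eq_zero (h hf))
    (Ideal.Quotient.lift_surjective_of_surjective _ _ (faceProj_surjective F))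

lemma ringKrullDim_quotient_faceIdeal_le (F : Finset (Fin n)) :
    ringKrullDim (MvPolynomial (Fin n) k ⧸ faceIdeal k F) ≤ F.card := by
  rw [← ringKrullDim_mvPolynomial_face (k := k)]
  let φ : MvPolynomial F k →ₐ[k] MvPolynomial (Fin n) k ⧸ faceIdeal k F :=
    aeval fun i => Ideal.Quotient.mk _ (X i.1)
  have hφ : φ.comp (faceProj k F) = Ideal.Quotient.mkₐ k (faceIdeal k F) := by
    refine algHom_ext fun i => ?_
    by_cases hi : i ∈ F
    · simp [φ, faceProj, hi]
    · simpa [φ, faceProj, hi] using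
        (Ideal.Quotient.eq_zero_iff_mem.2 (X_mem_faceIdeal (k := k) hi)).symm
  refine ringKrullDim_le_of_surjective (φ : MvPolynomial F k →+* _) fun y => ?_
  obtain ⟨f, rfl⟩ := Ideal.Quotient.mk_surjective y
  exact ⟨faceProj k F f, AlgHom.congr_fun hφ f⟩

lemma not_le_ringKrullDim {I : Ideal (MvPolynomial (Fin n) k)} {t : ℕ}
    (h : ∀ A : Finset (Fin n), A.card = t → ∏ i ∈ A, X i ∈ I) :
    ¬ (t : WithBot ℕ∞) ≤ ringKrullDim (MvPolynomial (Fin n) k ⧸ I) := by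
  classical
  rw [ringKrullDim_quotient, Order.le_krullDim_iff]
  rintro ⟨l, hl⟩
  obtain ⟨F, hF⟩ : ∃ F : Finset (Fin n), ∀ i, i ∈ F ↔ X i ∉ l.head.1.asIdeal :=
    ⟨Finset.univ.filter fun i => X i ∉ l.head.1.asIdeal, by simp⟩
  have hFt : F.card < t := by
    by_contra hle
    obtain ⟨A, hA, hAt⟩ := Finset.exists_subset_card_eq (not_lt.1 hle)
    have hmem := l.head.2 (h A hAt)
    obtain ⟨i, hi, hiA⟩ := (l.head.1.isPrime.prod_mem_iff).1 hmem
    exact (hF i).1 (hA hi) hiA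
  have hle : faceIdeal k F ≤ l.head.1.asIdeal := by
    rw [faceIdeal, Ideal.span_le]
    rintro _ ⟨i, hi, rfl⟩
    by_contra hi'
    simp [(hF i).2 hi'] at hi
  let l' : LTSeries (PrimeSpectrum.zeroLocus (faceIdeal k F : Set (MvPolynomial (Fin n) k))) :=
    { length := l.length
      toFun := fun i => ⟨(l i).1, hle.trans (LTSeries.head_le l i)⟩
      step := fun i => l.step i }
  have : (t : WithBot ℕ∞) ≤ ringKrullDim (MvPolynomial (Fin n) k ⧸ faceIdeal k F) := by
    rw [ringKrullDim_quotient, Order.le_krullDim_iff]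
    exact ⟨l', hl⟩
  have := this.trans (ringKrullDim_quotient_faceIdeal_le F)
  rw [Nat.cast_le] at this
  omega

lemma le_modDim_serreK_iff (hK : IsComplex K) {r j : ℕ} (hj : j ≤ n) :
    ((j + 1 - r : ℕ) : WithBot ℕ∞) ≤ modDim (serreK k (srRing k K) j) ↔
      ∃ F ∈ K, ∃ c, F.card + c = j ∧ c + 1 ≤ r ∧ ¬ HomologyVanishesAt k (link K F) c := by
  rw [modDim, serreK, Nat.card_fin]
  constructor
  · intro h
    by_contra! hvan
    refine not_le_ringKrullDim (fun A hA => ?_) h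
    refine prod_X_mem_annihilator hK (j := j) (by omega) A fun F hF c hAF hc => ?_
    have := Finset.card_le_card hAF
    exact hvan F hF c hc (by omega)
  · rintro ⟨F, hF, c, hc, hcr, hne⟩
    refine le_trans (Nat.cast_le.2 ?_)
      (card_le_ringKrullDim (annihilator_extM_srRing_le hK (by omega) hne))
    omega

lemma exists_not_homologyVanishesAt_zero (hK : IsComplex K) :
    ∃ F ∈ K, ¬ HomologyVanishesAt k (link K F) 0 := by
  classical
  obtain ⟨F, hF⟩ := (Set.toFinite K).exists_maximal hK.1
  refine ⟨F, hF.1, fun h => ?_⟩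
  have hmem : ∅ ∈ link K F := mem_link.2 ⟨by simpa using hF.1, by simp⟩
  obtain ⟨w, hw0, hw⟩ := h (fun C => if C = ∅ then 1 else 0) (fun C hC => if_neg (by
    rintro rfl
    exact hC hmem)) (fun D _ hD => absurd hD (Nat.succ_ne_zero _))
  have := hw ∅ hmem rfl
  rw [if_pos rfl, Finset.sum_eq_zero] at this
  · exact one_ne_zero this
  · intro x _
    rw [hw0, mul_zero]
    intro hx
    rw [mem_link] at hx
    refine Finset.disjoint_right.1 hx.2 (Finset.mem_insert_self x ∅) ?_
    exact hF.2 hx.1 Finset.subset_union_left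
      (Finset.mem_union_right _ (Finset.mem_insert_self x ∅))

end Dimension

/-- Lemma `depth`: for a pure simplicial complex `Δ` on `[n]` and `r ≥ 2`,
`s ≤ S_r-depth(k[Δ])` iff `H̃_i(link_Δ F; k) = 0` for all `i ≤ r - 2` and all faces
`F ∈ Δ` with `|F| ≤ s - i - 2`. -/
theorem serreDepth_le_iff_reduced_homology_of_links_vanishes
    (k : Type) [Field k] (n r : ℕ) (hr : 2 ≤ r)
    (K : Set (Finset (Fin n))) (hK : IsComplex K) (hpure : Pure K) (s : ℤ) :
    s ≤ (serreDepth k r (srRing k K) : ℤ) ↔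
      ∀ i : ℤ, i ≤ (r : ℤ) - 2 → ∀ F ∈ K, (F.card : ℤ) ≤ s - i - 2 →
        reducedHomologyVanishes k (link K F) i := by
  have hcard : ∀ F : Finset (Fin n), F.card ≤ n := fun F => by simpa using F.card_le_univ
  obtain ⟨F₁, hF₁, hne⟩ := exists_not_homologyVanishesAt_zero (k := k) hK
  have hF₁mem : F₁.card ∈
      {j : ℕ | ((j + 1 - r : ℕ) : WithBot ℕ∞) ≤ modDim (serreK k (srRing k K) j)} :=
    (le_modDim_serreK_iff hK (hcard F₁)).2 ⟨F₁, hF₁, 0, rfl, by omega, hne⟩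
  have hle : serreDepth k r (srRing k K) ≤ n := (Nat.sInf_le hF₁mem).trans (hcard F₁)
  constructor
  · intro hs i hir F hF hFs
    by_cases hi : i < -1
    · rw [reducedHomologyVanishes, if_pos hi]
      trivial
    · obtain ⟨c, rfl⟩ : ∃ c : ℕ, i = (c : ℤ) - 1 := ⟨(i + 1).toNat, by omega⟩
      rw [reducedHomologyVanishes_iff]
      by_contra hF'
      have : serreDepth k r (srRing k K) ≤ F.card + c :=
        Nat.sInf_le ((le_modDim_serreK_iff hK (by omega)).2 ⟨F, hF, c, rfl, by omega, hF'⟩)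
      omega
  · intro h
    by_contra hs
    obtain ⟨F, hF, c, hc, hcr, hF'⟩ :=
      (le_modDim_serreK_iff (k := k) (r := r) hK hle).1 (Nat.sInf_mem ⟨_, hF₁mem⟩)
    exact hF' ((reducedHomologyVanishes_iff c).1 (h (c - 1) (by omega) F hF (by omega)))

end SerrePaper
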